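/- arXiv:1708.01782 — 2 statements merged into one kernel-verified Lean document; each statement's English description precedes it below -/
import Mathlib

section
/- Let F be a field of characteristic different from two, and let p and q be (non-degenerate) quadratic forms over F. Considering the form p ⊥ x·q over the Laurent series field F((x)), its Witt index satisfies i(p ⊥ x·q) = i(p) + i(q). -/
set_option synthInstance.maxHeartbeats 1000000
set_option maxHeartbeats 4000000

open scoped BigOperators Classical

namespace QF

section Defs

variable {R : Type*} [CommRing R]

/-- Evaluation of the diagonal quadratic form with coefficients `d` at the vector `v`. -/
def evalQF {n : ℕ} (d : Fin n → R) (v : Fin n → R) : R := ∑ i, d i * v i ^ 2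

/-- A form is isotropic if it represents zero non-trivially. -/
def Isotropic {n : ℕ} (d : Fin n → R) : Prop := ∃ v : Fin n → R, v ≠ 0 ∧ evalQF d v = 0

def Anisotropic {n : ℕ} (d : Fin n → R) : Prop := ¬ Isotropic d

/-- Nondegeneracy of a diagonal form: all coefficients are nonzero. -/
def Nondeg {n : ℕ} (d : Fin n → R) : Prop := ∀ i, d i ≠ 0

/-- Two diagonal forms are isometric if a linear equivalence matches their values. -/
def Isometric {m n : ℕ} (d : Fin m → R) (e : Fin n → R) : Prop :=
  ∃ φ : (Fin m → R) ≃ₗ[R] (Fin n → R), ∀ v, evalQF e (φ v) = evalQF d v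

/-- Orthogonal sum of diagonal forms. -/
def osum {m n : ℕ} (d : Fin m → R) (e : Fin n → R) : Fin (m + n) → R := Fin.append d e

/-- Tensor product of diagonal forms. -/
def tensorQF {m n : ℕ} (d : Fin m → R) (e : Fin n → R) : Fin (m * n) → R :=
  fun i => d (finProdFinEquiv.symm i).1 * e (finProdFinEquiv.symm i).2

/-- Scaling of a form by a scalar. -/
def smulQF {n : ℕ} (a : R) (d : Fin n → R) : Fin n → R := fun i => a * d i

/-- `k` copies of the hyperbolic plane `⟨1,-1⟩`. -/
def hypform {R : Type*} [CommRing R] (k : ℕ) : Fin (k + k) → R :=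
  Fin.append (fun _ => 1) (fun _ => -1)

/-- A form is hyperbolic if it is isometric to a sum of hyperbolic planes,
i.e. its Witt index is half its dimension. -/
def IsHyperbolic {n : ℕ} (d : Fin n → R) : Prop := ∃ k : ℕ, Isometric d (hypform k)

/-- The Witt index: the largest `k` such that `d ≅ k×⟨1,-1⟩ ⊥ r`. -/
noncomputable def WittIndex {n : ℕ} (d : Fin n → R) : ℕ :=
  sSup {k : ℕ | ∃ (m : ℕ) (r : Fin m → R), Isometric d (osum (hypform k) r)}

/-- `r` is a subform of `d`: `d ≅ r ⊥ s` for some (nondegenerate) form `s`. -/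
def Subform {m n : ℕ} (r : Fin m → R) (d : Fin n → R) : Prop :=
  ∃ (k : ℕ) (s : Fin k → R), Nondeg s ∧ Isometric d (osum r s)

/-- The set of nonzero represented values. -/
def Dset {n : ℕ} (d : Fin n → R) : Set R :=
  {a | a ≠ 0 ∧ ∃ v : Fin n → R, evalQF d v = a}

/-- The group of similarity factors `G(q) = {a : a·q ≅ q}`. -/
def Gset {n : ℕ} (d : Fin n → R) : Set R :=
  {a | a ≠ 0 ∧ Isometric (smulQF a d) d}

/-- `H(q) = {a : ⟨1,-a⟩ ⊗ q is isotropic}`. -/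
def Hset {n : ℕ} (d : Fin n → R) : Set R :=
  {a | a ≠ 0 ∧ Isotropic (tensorQF ![1, -a] d)}

/-- Base change of a form along a ring homomorphism (e.g. a field extension). -/
def bc {S : Type*} [CommRing S] (f : R →+* S) {n : ℕ} (d : Fin n → R) : Fin n → S :=
  fun i => f (d i)

/-- The Pfister form `⟨1,a 0⟩ ⊗ ⋯ ⊗ ⟨1, a (n-1)⟩`: its `2^n` diagonal coefficients are
the products `∏_{j ∈ S} a j` over subsets `S` of the index set. -/
noncomputable def pfisterOf {n : ℕ} (a : Fin n → R) : Fin (2 ^ n) → R :=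
  fun i => ∏ j : Fin n, if (finFunctionFinEquiv.symm i) j = 0 then 1 else a j

/-- `π` is an `n`-fold Pfister form. -/
def IsNPfister (n : ℕ) {m : ℕ} (π : Fin m → R) : Prop :=
  ∃ a : Fin n → R, (∀ i, a i ≠ 0) ∧ Isometric π (pfisterOf a)

/-- `π` is a Pfister form. -/
def IsPfister {m : ℕ} (π : Fin m → R) : Prop := ∃ n : ℕ, IsNPfister n π

end Defs

/-- The quadric polynomial `p(X₁,…,Xₙ) = ∑ dᵢ Xᵢ²` attached to a diagonal form. -/
noncomputable def formPoly {F : Type*} [CommRing F] {n : ℕ} (d : Fin n → F) :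
    MvPolynomial (Fin n) F :=
  ∑ i, MvPolynomial.C (d i) * MvPolynomial.X i ^ 2

/-- The affine coordinate ring `F[X₁,…,Xₙ]/(p(X))` of the quadric `p = 0`. -/
abbrev CoordRing {F : Type*} [CommRing F] {n : ℕ} (d : Fin n → F) : Type _ :=
  MvPolynomial (Fin n) F ⧸ Ideal.span {formPoly d}

/-- The function field `F(p)` of the quadric `p = 0`: the total fraction ring of the
coordinate ring (the quotient field when the coordinate ring is a domain, i.e. when `p` is
anisotropic of dimension at least 2). -/
abbrev FunField {F : Type*} [Field F] {n : ℕ} (d : Fin n → F) : Type _ :=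
  FractionRing (CoordRing d)

end QF


namespace QF

/-- The symmetric bilinear form attached to a diagonal quadratic form. -/
def bilin {R : Type*} [CommRing R] {n : ℕ} (d : Fin n → R) :
    LinearMap.BilinForm R (Fin n → R) :=
  LinearMap.mk₂ R (fun u v => ∑ i, d i * u i * v i)
    (fun _ _ _ => by simp only [Pi.add_apply, mul_add, add_mul, Finset.sum_add_distrib])
    (fun _ _ _ => by
      simp only [Pi.smul_apply, smul_eq_mul, Finset.mul_sum]
      exact Finset.sum_congr rfl fun _ _ => by ring)
    (fun _ _ _ => by simp only [Pi.add_apply, mul_add, Finset.sum_add_distrib])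
    (fun _ _ _ => by
      simp only [Pi.smul_apply, smul_eq_mul, Finset.mul_sum]
      exact Finset.sum_congr rfl fun _ _ => by ring)

/-- A subspace is totally isotropic if the bilinear form vanishes on it. -/
def TotallyIsotropic {R : Type*} [CommRing R] {n : ℕ} (d : Fin n → R)
    (A : Submodule R (Fin n → R)) : Prop :=
  ∀ u ∈ A, ∀ v ∈ A, bilin d u v = 0

section CommRing

variable {R : Type*} [CommRing R] {m n : ℕ}

lemma bilin_apply (d u v : Fin n → R) : bilin d u v = ∑ i, d i * u i * v i := rfl

lemma bilin_self (d v : Fin n → R) : bilin d v v = evalQF d v := by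
  rw [bilin_apply, evalQF]
  exact Finset.sum_congr rfl fun _ _ => by ring

lemma bilin_comm (d u v : Fin n → R) : bilin d u v = bilin d v u := by
  rw [bilin_apply, bilin_apply]
  exact Finset.sum_congr rfl fun _ _ => by ring

lemma bilin_osum (d : Fin m → R) (e : Fin n → R) (u v : Fin (m + n) → R) :
    bilin (osum d e) u v =
      bilin d (fun i => u (Fin.castAdd n i)) (fun i => v (Fin.castAdd n i)) +
      bilin e (fun i => u (Fin.natAdd m i)) (fun i => v (Fin.natAdd m i)) := by
  simp [bilin_apply, osum, Fin.sum_univ_add]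

lemma bilin_smulQF (a : R) (d u v : Fin n → R) :
    bilin (smulQF a d) u v = a * bilin d u v := by
  simp only [bilin_apply, smulQF, Finset.mul_sum, mul_assoc]

lemma bilin_bc {S : Type*} [CommRing S] (f : R →+* S) (d u v : Fin n → R) :
    bilin (bc f d) (fun i => f (u i)) (fun i => f (v i)) = f (bilin d u v) := by
  simp [bilin_apply, bc]

lemma bilin_eq_zero_of_evalQF (h2 : ∀ a : R, 2 * a = 0 → a = 0) (d u v : Fin n → R)
    (hu : evalQF d u = 0) (hv : evalQF d v = 0) (huv : evalQF d (u + v) = 0) :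
    bilin d u v = 0 := by
  apply h2
  rw [← bilin_self] at hu hv huv
  simp only [map_add, LinearMap.add_apply, hu, hv, bilin_comm d v u] at huv
  linear_combination huv

lemma totallyIsotropic_span {d : Fin n → R} {ι : Type*} {w : ι → Fin n → R}
    (hw : ∀ i j, bilin d (w i) (w j) = 0) :
    TotallyIsotropic d (Submodule.span R (Set.range w)) := by
  intro u hu v hv
  induction hu, hv using Submodule.span_induction₂ with
  | mem_mem x y hx hy =>
    obtain ⟨i, rfl⟩ := hx
    obtain ⟨j, rfl⟩ := hy
    exact hw i j
  | zero_left => simp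
  | zero_right => simp
  | add_left _ _ _ _ _ _ h₁ h₂ => simp [h₁, h₂]
  | add_right _ _ _ _ _ _ h₁ h₂ => simp [h₁, h₂]
  | smul_left _ _ _ _ _ h => simp [h]
  | smul_right _ _ _ _ _ h => simp [h]

end CommRing

section Field

variable {K : Type*} [Field K] {n : ℕ}

lemma evalQF_linearCombination (d : Fin n → K) {k : ℕ} (h : Fin k → Fin n → K) (e : Fin k → K)
    (he : ∀ i j, bilin d (h i) (h j) = if i = j then e i else 0) (v : Fin k → K) :
    evalQF d (∑ i, v i • h i) = evalQF e v := by
  rw [← bilin_self]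
  simp only [map_sum, map_smul, LinearMap.sum_apply, LinearMap.smul_apply, he, smul_eq_mul,
    mul_ite, mul_zero, Finset.sum_ite_eq', Finset.mem_univ, if_true]
  exact Finset.sum_congr rfl fun _ _ => by ring

/-- A nondegenerate diagonal form spanned by an orthogonal family splits off. -/
lemma exists_isometric_osum (h2 : (2 : K) ≠ 0) (d : Fin n → K) {s : ℕ} (e : Fin s → K)
    (he : Nondeg e) (g : Fin s → Fin n → K)
    (hg : ∀ i j, bilin d (g i) (g j) = if i = j then e i else 0) :
    ∃ (t : ℕ) (r : Fin t → K), Isometric d (osum e r) := by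
  let P : (Fin n → K) →ₗ[K] (Fin s → K) :=
    LinearMap.pi fun j => (e j)⁻¹ • bilin d (g j)
  have hP : ∀ v j, P v j = (e j)⁻¹ * bilin d (g j) v := fun v j => rfl
  have hPg : ∀ c : Fin s → K, P (∑ i, c i • g i) = c := by
    intro c
    ext j
    rw [hP]
    simp only [map_sum, map_smul, hg, smul_eq_mul, mul_ite, mul_zero, Finset.sum_ite_eq,
      Finset.mem_univ, if_true]
    field_simp [he j]
  have hgP : ∀ v, P v = 0 → ∀ j, bilin d (g j) v = 0 := by
    intro v hv j
    have := congrFun hv j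
    rw [hP] at this
    simpa [he j] using this
  let T := LinearMap.ker P
  have : Invertible (2 : K) := invertibleOfNonzero h2
  obtain ⟨w, hw⟩ := LinearMap.BilinForm.exists_orthogonal_basis
    (B := (bilin d).restrict T) ⟨fun x y => bilin_comm d x y⟩
  have hwP : ∀ j, P (w j : Fin n → K) = 0 := fun j => (w j).2
  let r : Fin (Module.finrank K T) → K := fun j => bilin d (w j) (w j)
  let h : Fin (s + Module.finrank K T) → Fin n → K := Fin.append g fun j => (w j : Fin n → K)
  refine ⟨_, r, ?_⟩
  have hh : ∀ i j, bilin d (h i) (h j) = if i = j then osum e r i else 0 := by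
    intro i j
    induction i using Fin.addCases with
    | left i =>
      induction j using Fin.addCases with
      | left j => simp [h, osum, hg]
      | right j =>
        have : Fin.castAdd _ i ≠ Fin.natAdd s j := by
          intro h; have := congrArg Fin.val h; simp at this; omega
        simp [h, this, hgP _ (hwP j)]
    | right i =>
      induction j using Fin.addCases with
      | left j =>
        have : Fin.natAdd s i ≠ Fin.castAdd _ j := by
          intro h; have := congrArg Fin.val h; simp at this; omega
        simp [h, this, bilin_comm d _ (g j), hgP _ (hwP i)]
      | right j =>
        by_cases hij : i = j
        · subst hij; simp [h, osum, r]
        · have := hw hij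
          simp only [Function.onFun] at this
          simpa [h, hij] using this
  let Φ := Fintype.linearCombination K h
  have hΦ : ∀ v, Φ v = ∑ i, v (Fin.castAdd _ i) • g i +
      ((∑ j, v (Fin.natAdd s j) • w j : T) : Fin n → K) := by
    intro v
    simp [Φ, Fintype.linearCombination_apply, Fin.sum_univ_add, h]
  have hPΦ : ∀ v, P (Φ v) = fun i => v (Fin.castAdd _ i) := by
    intro v
    rw [hΦ, map_add, hPg, (Subtype.prop (∑ j, v (Fin.natAdd s j) • w j : T) : P _ = 0), add_zero]
  have inj : Function.Injective Φ := by
    rw [injective_iff_map_eq_zero]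
    intro v hv
    have h1 : ∀ i, v (Fin.castAdd _ i) = 0 := fun i => by
      have := congrFun (hPΦ v) i
      rw [hv] at this
      simpa using this.symm
    have h3 : (∑ j, v (Fin.natAdd s j) • w j : T) = 0 := by
      have := hΦ v
      rw [hv] at this
      simp only [h1, zero_smul, Finset.sum_const_zero, zero_add] at this
      exact Subtype.ext this.symm
    have h4 := Fintype.linearIndependent_iff.1 w.linearIndependent _ h3
    ext i
    induction i using Fin.addCases with
    | left i => exact h1 i
    | right i => exact h4 i
  have surj : Function.Surjective Φ := by
    intro u
    have hu : u - ∑ i, P u i • g i ∈ T := by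
      rw [LinearMap.mem_ker, map_sub, hPg, sub_self]
    refine ⟨Fin.append (P u) (w.repr ⟨_, hu⟩), ?_⟩
    rw [hΦ]
    simp only [Fin.append_left, Fin.append_right, w.sum_repr]
    abel
  refine ⟨(LinearEquiv.ofBijective Φ ⟨inj, surj⟩).symm, fun v => ?_⟩
  obtain ⟨v, rfl⟩ := surj v
  have : (LinearEquiv.ofBijective Φ ⟨inj, surj⟩).symm (Φ v) = v :=
    LinearEquiv.ofBijective_symm_apply_apply Φ v
  rw [this]
  exact (evalQF_linearCombination d h _ hh v).symm

lemma wittIndex_bddAbove (d : Fin n → K) :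
    BddAbove {k : ℕ | ∃ (m : ℕ) (r : Fin m → K), Isometric d (osum (hypform k) r)} := by
  refine ⟨n, ?_⟩
  rintro k ⟨m, r, φ, -⟩
  have := φ.finrank_eq
  simp at this
  omega

/-- The dimension of a totally isotropic subspace is bounded by the Witt index. -/
lemma TotallyIsotropic.finrank_le_wittIndex (h2 : (2 : K) ≠ 0) {d : Fin n → K} (hd : Nondeg d)
    {A : Submodule K (Fin n → K)} (hA : TotallyIsotropic d A) :
    Module.finrank K A ≤ WittIndex d := by
  refine le_csSup (wittIndex_bddAbove d) ?_
  set a := Module.finrank K A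
  let e : Module.Basis (Fin a) K A := Module.finBasis K A
  have hf : ∀ j, ∃ f : Fin n → K, ∀ i, bilin d (e i) f = if i = j then 1 else 0 := by
    intro j
    obtain ⟨φ, hφ⟩ := LinearMap.exists_extend (e.coord j)
    refine ⟨fun i => (d i)⁻¹ * φ (Pi.single i 1), fun i => ?_⟩
    have h1 : φ (e i) = if i = j then 1 else 0 := by
      have := LinearMap.congr_fun hφ (e i)
      simpa [Finsupp.single_apply] using this
    rw [← h1, LinearMap.pi_apply_eq_sum_univ φ, bilin_apply]
    refine Finset.sum_congr rfl fun k _ => ?_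
    have := hd k
    have h3 : (Pi.single k 1 : Fin n → K) = fun j => if k = j then 1 else 0 := by
      ext j; simp [Pi.single_apply, eq_comm]
    rw [h3, smul_eq_mul]
    field_simp
  choose f hf using hf
  have hee : ∀ i j, bilin d (e i) (e j) = 0 := fun i j => hA _ (e i).2 _ (e j).2
  let f' : Fin a → Fin n → K := fun j =>
    f j - ∑ i, ((2 : K)⁻¹ * bilin d (f i) (f j)) • (e i : Fin n → K)
  have hef : ∀ i j, bilin d (e i) (f' j) = if i = j then 1 else 0 := by
    intro i j
    simp [f', map_sub, map_sum, hf, hee]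
  have hff : ∀ i j, bilin d (f' i) (f' j) = 0 := by
    intro i j
    have h1 : ∀ k, bilin d (f' i) (e k) = if k = i then 1 else 0 := fun k => by
      rw [bilin_comm, hef]
    have h3 : bilin d (f' i) (f j) = 2⁻¹ * bilin d (f i) (f j) := by
      simp only [f', map_sub, map_sum, LinearMap.sub_apply, LinearMap.sum_apply,
        LinearMap.smul_apply, map_smul, hf, smul_eq_mul, mul_ite, mul_one, mul_zero,
        Finset.sum_ite_eq', Finset.mem_univ, if_true, bilin_comm d (f j) (f i)]
      field_simp
      ring
    have h4 : bilin d (f' i) (f' j) = bilin d (f' i) (f j) -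
        ∑ k, (2 : K)⁻¹ * bilin d (f k) (f j) * bilin d (f' i) (e k) := by
      conv_lhs => rw [show f' j = f j -
        ∑ i, ((2 : K)⁻¹ * bilin d (f i) (f j)) • (e i : Fin n → K) from rfl]
      simp only [map_sub, map_sum, map_smul, smul_eq_mul]
    rw [h4, h3]
    simp [h1]
  have hfe : ∀ i j, bilin d (f' i) (e j) = if i = j then 1 else 0 := fun i j => by
    rw [bilin_comm, hef]; simp [eq_comm]
  refine exists_isometric_osum h2 d (hypform a) ?_
    (Fin.append (fun i => (e i : Fin n → K) + (2 : K)⁻¹ • f' i)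
      (fun i => (e i : Fin n → K) - (2 : K)⁻¹ • f' i)) ?_
  · intro i
    induction i using Fin.addCases <;> simp [hypform, -Fin.natAdd_eq_addNat]
  · intro i j
    have key : (2 : K)⁻¹ + 2⁻¹ = 1 := by field_simp; norm_num
    induction i using Fin.addCases with
    | left i =>
      induction j using Fin.addCases with
      | left j =>
        simp only [Fin.append_left, map_add, map_smul, LinearMap.add_apply, LinearMap.smul_apply,
          hee, hef, hfe, hff, hypform, Fin.castAdd_inj, smul_eq_mul]
        split_ifs <;> simp [key]
      | right j =>
        have : Fin.castAdd a i ≠ Fin.natAdd a j := by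
          intro h; have := congrArg Fin.val h; simp at this; omega
        simp [this, hee, hef, hfe, hff, -Fin.natAdd_eq_addNat]
    | right i =>
      induction j using Fin.addCases with
      | left j =>
        have : Fin.natAdd a i ≠ Fin.castAdd a j := by
          intro h; have := congrArg Fin.val h; simp at this; omega
        simp [this, hee, hef, hfe, hff, -Fin.natAdd_eq_addNat]
      | right j =>
        simp only [Fin.append_right, map_sub, map_smul, LinearMap.sub_apply, LinearMap.smul_apply,
          hee, hef, hfe, hff, hypform, Fin.natAdd_inj, smul_eq_mul]
        split_ifs
        · simp only [mul_one, mul_zero]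
          linear_combination -key
        · simp

/-- The Witt index is attained by a linearly independent family spanning a totally isotropic
subspace. -/
lemma exists_isotropic_family (h2 : (2 : K) ≠ 0) (d : Fin n → K) :
    ∃ w : Fin (WittIndex d) → Fin n → K, LinearIndependent K w ∧
      ∀ i j, bilin d (w i) (w j) = 0 := by
  have hne : {k : ℕ | ∃ (m : ℕ) (r : Fin m → K), Isometric d (osum (hypform k) r)}.Nonempty := by
    obtain ⟨t, r, h⟩ := exists_isometric_osum h2 d (hypform 0) (fun i => i.elim0)
      (fun i => i.elim0) (fun i => i.elim0)
    exact ⟨0, t, r, h⟩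
  obtain ⟨m, r, φ, hφ⟩ := Nat.sSup_mem hne (wittIndex_bddAbove d)
  rw [WittIndex]
  generalize sSup {k : ℕ | ∃ (m : ℕ) (r : Fin m → K), Isometric d (osum (hypform k) r)} = k
    at r φ hφ
  let inc : (Fin k → K) →ₗ[K] (Fin (k + k + m) → K) :=
    { toFun := fun v => Fin.append (Fin.append v v) 0
      map_add' := fun u v => by
        ext i
        induction i using Fin.addCases with
        | left i =>
          induction i using Fin.addCases <;> simp [-Fin.natAdd_eq_addNat]
        | right i => simp
      map_smul' := fun c v => by
        ext i
        induction i using Fin.addCases with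
        | left i =>
          induction i using Fin.addCases <;> simp [-Fin.natAdd_eq_addNat]
        | right i => simp }
  have hinc : ∀ v, inc v = Fin.append (Fin.append v v) 0 := fun _ => rfl
  have inj : Function.Injective inc := by
    intro u v huv
    ext i
    simpa [hinc] using congrFun huv (Fin.castAdd m (Fin.castAdd k i))
  have h0 : ∀ v, evalQF d (φ.symm (inc v)) = 0 := by
    intro v
    rw [← hφ, LinearEquiv.apply_symm_apply, hinc]
    simp [evalQF, osum, hypform, Fin.sum_univ_add, -Fin.natAdd_eq_addNat]
  have hT : ∀ a : K, 2 * a = 0 → a = 0 := fun a ha => (mul_eq_zero.1 ha).resolve_left h2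
  refine ⟨fun i => φ.symm (inc (Pi.basisFun K (Fin k) i)), ?_, fun i j => ?_⟩
  · exact (Pi.basisFun K (Fin k)).linearIndependent.map'
      (φ.symm.toLinearMap ∘ₗ inc) (LinearMap.ker_eq_bot.2 (φ.symm.injective.comp inj))
  · refine bilin_eq_zero_of_evalQF hT d _ _ (h0 _) (h0 _) ?_
    rw [← map_add, ← map_add]
    exact h0 _

end Field

section Laurent

variable {F : Type*} [Field F] {m n : ℕ}

/-- The form `p ⊥ x·q` over the Laurent series field. -/
noncomputable abbrev laurentSum (p : Fin m → F) (q : Fin n → F) :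
    Fin (m + n) → LaurentSeries F :=
  osum (bc (algebraMap F (LaurentSeries F)) p)
    (smulQF (HahnSeries.single 1 1) (bc (algebraMap F (LaurentSeries F)) q))

lemma bilin_laurentSum (p : Fin m → F) (q : Fin n → F) (u v : Fin (m + n) → LaurentSeries F) :
    bilin (laurentSum p q) u v =
      bilin (bc (algebraMap F (LaurentSeries F)) p)
        (fun i => u (Fin.castAdd n i)) (fun i => v (Fin.castAdd n i)) +
      HahnSeries.single 1 1 * bilin (bc (algebraMap F (LaurentSeries F)) q)
        (fun i => u (Fin.natAdd m i)) (fun i => v (Fin.natAdd m i)) := by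
  rw [bilin_osum, bilin_smulQF]

lemma wittIndex_add_le (h2 : (2 : F) ≠ 0) (p : Fin m → F) (q : Fin n → F)
    (hp : Nondeg p) (hq : Nondeg q) :
    WittIndex p + WittIndex q ≤ WittIndex (laurentSum p q) := by
  obtain ⟨w, hw, hw0⟩ := exists_isotropic_family h2 p
  obtain ⟨z, hz, hz0⟩ := exists_isotropic_family h2 q
  let c := algebraMap F (LaurentSeries F)
  have h2' : (2 : LaurentSeries F) ≠ 0 := by
    have := (map_ne_zero c).2 h2
    rwa [map_ofNat] at this
  have hpq : Nondeg (laurentSum p q) := by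
    intro i
    induction i using Fin.addCases with
    | left i => simpa [osum, bc] using hp i
    | right i => simpa [osum, bc, smulQF] using hq i
  let w' : Fin (WittIndex p) → Fin (m + n) → LaurentSeries F :=
    fun i => Fin.append (fun j => c (w i j)) 0
  let z' : Fin (WittIndex q) → Fin (m + n) → LaurentSeries F :=
    fun i => Fin.append 0 (fun j => c (z i j))
  have hw' := (linearIndependent_algebraMap_comp_iff (S := LaurentSeries F)).2 hw
  have hz' := (linearIndependent_algebraMap_comp_iff (S := LaurentSeries F)).2 hz
  have hli : LinearIndependent (LaurentSeries F) (Sum.elim w' z') := by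
    rw [Fintype.linearIndependent_iff] at hw' hz' ⊢
    intro g hg
    simp only [Fintype.sum_sum_type, Sum.elim_inl, Sum.elim_inr] at hg
    have h1 := hw' (fun i => g (Sum.inl i)) (by
      ext1 j
      simpa [w', z', c] using congrFun hg (Fin.castAdd n j))
    have h3 := hz' (fun i => g (Sum.inr i)) (by
      ext1 j
      simpa [w', z', c] using congrFun hg (Fin.natAdd m j))
    rintro (i | i)
    · exact h1 i
    · exact h3 i
  have hiso : TotallyIsotropic (laurentSum p q)
      (Submodule.span _ (Set.range (Sum.elim w' z'))) := by
    apply totallyIsotropic_span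
    rintro (i | i) (j | j)
    · have := bilin_bc c p (w i) (w j)
      rw [hw0, map_zero] at this
      rw [bilin_laurentSum]
      simpa [w', bilin_apply] using this
    · rw [bilin_laurentSum]
      simp [w', z', bilin_apply]
    · rw [bilin_laurentSum]
      simp [w', z', bilin_apply]
    · have := bilin_bc c q (z i) (z j)
      rw [hz0, map_zero] at this
      rw [bilin_laurentSum]
      simpa [z', bilin_apply] using this
  have := hiso.finrank_le_wittIndex h2' hpq
  rw [finrank_span_eq_card hli] at this
  simpa using this

lemma finrank_le_of_basis_lattice {R K : Type*} [CommRing R] [IsDomain R] [Field K] [Algebra R K]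
    [IsFractionRing R K] (W : Submodule K (Fin n → K)) {L : Submodule R (Fin n → R)}
    (hL : ∀ v, v ∈ L ↔ (fun i => algebraMap R K (v i)) ∈ W) {r : ℕ}
    (b : Module.Basis (Fin r) R L) : Module.finrank K W ≤ r := by
  let β : Fin r → Fin n → K := fun i j => algebraMap R K ((b i : Fin n → R) j)
  have hW : W ≤ Submodule.span K (Set.range β) := by
    intro w hw
    obtain ⟨a, ha⟩ := IsLocalization.exist_integer_multiples_of_finite (nonZeroDivisors R) w
    choose v hv using ha
    have ha0 : algebraMap R K a ≠ 0 := by simp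
    have hvw : (fun i => algebraMap R K (v i)) = algebraMap R K a • w := by
      ext i
      rw [hv, Algebra.smul_def]
      rfl
    have hvL : v ∈ L := by
      rw [hL, hvw]
      exact W.smul_mem _ hw
    have hsum : algebraMap R K a • w = ∑ i, algebraMap R K (b.repr ⟨v, hvL⟩ i) • β i := by
      rw [← hvw]
      ext j
      have := congrArg (fun x : L => (x : Fin n → R) j) (b.sum_repr ⟨v, hvL⟩)
      simp only [AddSubmonoidClass.coe_finsetSum, Finset.sum_apply, Submodule.coe_smul,
        Pi.smul_apply, smul_eq_mul] at this
      rw [← this]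
      simp [β, Algebra.smul_def]
    have : algebraMap R K a • w ∈ Submodule.span K (Set.range β) := by
      rw [hsum]
      exact Submodule.sum_mem _ fun i _ =>
        Submodule.smul_mem _ _ (Submodule.subset_span ⟨i, rfl⟩)
    exact (Submodule.smul_mem_iff _ ha0).1 this
  calc Module.finrank K W ≤ Module.finrank K (Submodule.span K (Set.range β)) :=
        Submodule.finrank_mono hW
    _ ≤ r := by
        have := finrank_range_le_card (R := K) β
        rwa [Fintype.card_fin] at this

lemma algebraMap_X :
    algebraMap (PowerSeries F) (LaurentSeries F) PowerSeries.X = HahnSeries.single 1 1 :=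
  HahnSeries.ofPowerSeries_X

lemma TotallyIsotropic.finrank_le_add (p : Fin m → F) (q : Fin n → F)
    {W : Submodule (LaurentSeries F) (Fin (m + n) → LaurentSeries F)}
    (hW : TotallyIsotropic (laurentSum p q) W) :
    ∃ (A : Submodule F (Fin m → F)) (B : Submodule F (Fin n → F)),
      TotallyIsotropic p A ∧ TotallyIsotropic q B ∧
      Module.finrank (LaurentSeries F) W ≤ Module.finrank F A + Module.finrank F B := by
  let O := PowerSeries F
  let ι := algebraMap (PowerSeries F) (LaurentSeries F)
  have hι : Function.Injective ι := IsFractionRing.injective _ _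
  let L : Submodule O (Fin (m + n) → O) :=
    { carrier := {v | (fun i => ι (v i)) ∈ W}
      add_mem' := fun {u v} hu hv => by
        have := W.add_mem hu hv
        simpa [Pi.add_def] using this
      zero_mem' := by
        have := W.zero_mem
        simpa [Pi.zero_def] using this
      smul_mem' := fun c v hv => by
        have := W.smul_mem (ι c) hv
        simpa [Pi.smul_def] using this }
  have hL : ∀ v, v ∈ L ↔ (fun i => ι (v i)) ∈ W := fun _ => Iff.rfl
  obtain ⟨r, b⟩ := Submodule.basisOfPid (Pi.basisFun O (Fin (m + n))) L
  have hLiso : ∀ u ∈ L, ∀ v ∈ L,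
      bilin (bc PowerSeries.C p) (fun i => u (Fin.castAdd n i)) (fun i => v (Fin.castAdd n i)) +
      PowerSeries.X * bilin (bc PowerSeries.C q)
        (fun i => u (Fin.natAdd m i)) (fun i => v (Fin.natAdd m i)) = 0 := by
    intro u hu v hv
    apply hι
    have h := hW _ hu _ hv
    rw [bilin_laurentSum] at h
    rw [map_add, map_mul, map_zero, ← bilin_bc, ← bilin_bc, algebraMap_X, ← h]
    rfl
  let T : (Fin r → F) →ₗ[F] (Fin (m + n) → O) :=
    Fintype.linearCombination F fun i => (b i : Fin (m + n) → O)
  have hT : ∀ c, T c = ((∑ i, PowerSeries.C (c i) • b i : L) : Fin (m + n) → O) := by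
    intro c
    ext1 j
    simp only [T, Fintype.linearCombination_apply, AddSubmonoidClass.coe_finsetSum,
      Finset.sum_apply, Submodule.coe_smul, Pi.smul_apply, smul_eq_mul]
    exact Finset.sum_congr rfl fun _ _ => PowerSeries.smul_eq_C_mul _ _
  have hTL : ∀ c, T c ∈ L := fun c => by rw [hT]; exact Subtype.prop _
  let red : (Fin (m + n) → O) →ₗ[F] (Fin (m + n) → F) :=
    (PowerSeries.coeff (R := F) 0).compLeft (Fin (m + n))
  let α : (Fin r → F) →ₗ[F] (Fin m → F) := LinearMap.funLeft F F (Fin.castAdd n) ∘ₗ red ∘ₗ T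
  let β : (Fin r → F) →ₗ[F] (Fin n → F) := LinearMap.funLeft F F (Fin.natAdd m) ∘ₗ red ∘ₗ T
  have hα : ∀ c i, α c i = PowerSeries.constantCoeff (T c (Fin.castAdd n i)) := fun c i => by
    rw [← PowerSeries.coeff_zero_eq_constantCoeff_apply]; rfl
  have hβ : ∀ c i, β c i = PowerSeries.constantCoeff (T c (Fin.natAdd m i)) := fun c i => by
    rw [← PowerSeries.coeff_zero_eq_constantCoeff_apply]; rfl
  have hbC : ∀ {k : ℕ} (d : Fin k → F), bc PowerSeries.constantCoeff (bc PowerSeries.C d) = d := by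
    intro k d
    ext i
    simp [bc]
  refine ⟨LinearMap.range α, LinearMap.range (β.domRestrict (LinearMap.ker α)), ?_, ?_, ?_⟩
  · rintro _ ⟨u, rfl⟩ _ ⟨v, rfl⟩
    have h := congrArg PowerSeries.constantCoeff (hLiso _ (hTL u) _ (hTL v))
    rw [map_add, map_mul, PowerSeries.constantCoeff_X, zero_mul, add_zero, map_zero,
      ← bilin_bc, hbC] at h
    rwa [show α u = _ from funext (hα u), show α v = _ from funext (hα v)]
  · rintro _ ⟨⟨u, hu⟩, rfl⟩ _ ⟨⟨v, hv⟩, rfl⟩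
    have hdiv : ∀ c, c ∈ LinearMap.ker α →
        ∃ t : Fin m → O, (fun i => T c (Fin.castAdd n i)) = PowerSeries.X (R := F) • t := by
      intro c hc
      have : ∀ i, ∃ t, T c (Fin.castAdd n i) = PowerSeries.X * t := fun i => by
        apply PowerSeries.X_dvd_iff.2
        rw [← hα, LinearMap.mem_ker.1 hc]
        rfl
      choose t ht using this
      exact ⟨t, funext ht⟩
    obtain ⟨s, hs⟩ := hdiv u hu
    obtain ⟨t, ht⟩ := hdiv v hv
    have h := hLiso _ (hTL u) _ (hTL v)
    rw [hs, ht] at h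
    simp only [map_smul, LinearMap.smul_apply, smul_eq_mul] at h
    rw [← mul_add, mul_eq_zero, or_iff_right PowerSeries.X_ne_zero] at h
    have h := congrArg PowerSeries.constantCoeff h
    rw [map_add, map_mul, PowerSeries.constantCoeff_X, zero_mul, zero_add, map_zero,
      ← bilin_bc, hbC] at h
    simp only [LinearMap.domRestrict_apply]
    rwa [show β u = _ from funext (hβ u), show β v = _ from funext (hβ v)]
  · have inj : Function.Injective (β.domRestrict (LinearMap.ker α)) := by
      rw [injective_iff_map_eq_zero]
      rintro ⟨c, hc⟩ h
      rw [LinearMap.domRestrict_apply] at h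
      have : ∀ i, ∃ t, T c i = PowerSeries.X * t := fun i => by
        apply PowerSeries.X_dvd_iff.2
        induction i using Fin.addCases with
        | left i => rw [← hα, LinearMap.mem_ker.1 hc]; rfl
        | right i => rw [← hβ]; exact congrFun h i
      choose t ht using this
      have htL : t ∈ L := by
        have h1 : (fun i => ι (T c i)) ∈ W := hTL c
        have h3 : (fun i => ι (T c i)) = ι PowerSeries.X • fun i => ι (t i) := by
          ext1 i
          rw [ht, map_mul]
          rfl
        rw [h3, Submodule.smul_mem_iff _ ((map_ne_zero_iff ι hι).2 PowerSeries.X_ne_zero)] at h1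
        exact h1
      have hsum : (∑ i, PowerSeries.C (c i) • b i : L) = PowerSeries.X (R := F) • ⟨t, htL⟩ := by
        apply Subtype.ext
        rw [← hT]
        exact funext ht
      apply Subtype.ext
      ext i
      have h1 := congrArg (fun x : L => PowerSeries.constantCoeff (b.repr x i)) hsum
      rw [map_smul, Finsupp.smul_apply, smul_eq_mul, map_mul, PowerSeries.constantCoeff_X,
        zero_mul, b.repr_sum_self, PowerSeries.constantCoeff_C] at h1
      exact h1
    rw [LinearMap.finrank_range_of_inj inj, LinearMap.finrank_range_add_finrank_ker]
    simpa using finrank_le_of_basis_lattice W hL b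

end Laurent

end QF

open QF in
/-- If `p` and `q` are (nondegenerate) forms over `F` (char `F ≠ 2`), then over the Laurent
series field `F((x))` the Witt index of `p ⊥ x·q` equals `i(p) + i(q)`. -/
theorem stmt_0 {F : Type*} [Field F] (h2 : (2 : F) ≠ 0)
    {m n : ℕ} (hm : 0 < m) (hn : 0 < n)
    (p : Fin m → F) (q : Fin n → F) (hp : Nondeg p) (hq : Nondeg q) :
    WittIndex
      (osum (bc (algebraMap F (LaurentSeries F)) p)
        (smulQF (HahnSeries.single 1 1) (bc (algebraMap F (LaurentSeries F)) q)))
      = WittIndex p + WittIndex q := by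
  apply le_antisymm _ (wittIndex_add_le h2 p q hp hq)
  have h2' : (2 : LaurentSeries F) ≠ 0 := by
    have := (map_ne_zero (algebraMap F (LaurentSeries F))).2 h2
    rwa [map_ofNat] at this
  obtain ⟨w, hw, hw0⟩ := exists_isotropic_family h2' (laurentSum p q)
  obtain ⟨A, B, hA, hB, h⟩ := (totallyIsotropic_span hw0).finrank_le_add p q
  rw [finrank_span_eq_card hw, Fintype.card_fin] at h
  exact h.trans (add_le_add (hA.finrank_le_wittIndex h2 hp) (hB.finrank_le_wittIndex h2 hq))
end

section
/- Let F be a field of characteristic different from two. An anisotropic form q over F is hyperbolic over F(p) for some form p over F if and only if q ≅ π ⊗ r for some n-fold Pfister form π (n ≥ 1) and some form r over F. -/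
set_option synthInstance.maxHeartbeats 1000000
set_option maxHeartbeats 4000000

open scoped BigOperators Classical

namespace QF

section Basic

variable {R : Type*} [CommRing R]

/-- The symmetric bilinear form attached to a diagonal form. -/
def bil {n : ℕ} (d : Fin n → R) : LinearMap.BilinForm R (Fin n → R) :=
  Matrix.toBilin' (Matrix.diagonal d)

lemma bil_apply {n : ℕ} (d v w : Fin n → R) : bil d v w = ∑ i, d i * v i * w i := by
  simp [bil, Matrix.toBilin'_apply', dotProduct, Matrix.mulVec_diagonal]
  exact Finset.sum_congr rfl fun i _ => by ring

lemma bil_comm {n : ℕ} (d v w : Fin n → R) : bil d v w = bil d w v := by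
  simp only [bil_apply]
  exact Finset.sum_congr rfl fun i _ => by ring

lemma bil_self {n : ℕ} (d v : Fin n → R) : bil d v v = evalQF d v := by
  simp only [bil_apply, evalQF]
  exact Finset.sum_congr rfl fun i _ => by ring

lemma evalQF_add {n : ℕ} (d v w : Fin n → R) :
    evalQF d (v + w) = evalQF d v + evalQF d w + 2 * bil d v w := by
  simp only [← bil_self, map_add, LinearMap.add_apply, bil_comm d w v]
  ring

lemma evalQF_smul {n : ℕ} (d : Fin n → R) (a : R) (v : Fin n → R) :
    evalQF d (a • v) = a ^ 2 * evalQF d v := by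
  simp only [← bil_self, map_smul, LinearMap.smul_apply, smul_eq_mul]
  ring

lemma transpose_mul_diagonal_mul {m n : ℕ} (e : Fin n → R) (P Q : Matrix (Fin n) (Fin m) R)
    (i j : Fin m) :
    (P.transpose * Matrix.diagonal e * Q) i j = bil e (fun k => P k i) (fun k => Q k j) := by
  rw [Matrix.mul_apply, bil_apply]
  refine Finset.sum_congr rfl fun i _ => ?_
  rw [Matrix.mul_diagonal, Matrix.transpose_apply]
  ring

lemma bil_mulVec {m n : ℕ} (e : Fin n → R) (P Q : Matrix (Fin n) (Fin m) R) (u v : Fin m → R) :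
    bil e (P.mulVec u) (Q.mulVec v) =
      Matrix.toBilin' (P.transpose * Matrix.diagonal e * Q) u v := by
  simp only [bil, Matrix.toBilin'_apply', ← Matrix.mulVec_mulVec, Matrix.dotProduct_mulVec,
    Matrix.vecMul_transpose, Matrix.vecMul_vecMul]

/-- A matrix carries the diagonal form `d` to the diagonal form `e` as soon as it is compatible
with values, provided `2` is invertible. -/
lemma transpose_mul_diagonal_mul_eq (h2 : IsUnit (2 : R)) {m n : ℕ} (e : Fin n → R)
    (d : Fin m → R) (P : Matrix (Fin n) (Fin m) R)
    (h : ∀ u, evalQF e (P.mulVec u) = evalQF d u) :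
    P.transpose * Matrix.diagonal e * P = Matrix.diagonal d := by
  apply Matrix.toBilin'.injective
  ext i j
  simp only [LinearMap.comp_apply]
  rw [← bil_mulVec]
  change _ = bil d _ _
  generalize hu : LinearMap.single R (fun _ : Fin m => R) i 1 = u
  generalize hv : LinearMap.single R (fun _ : Fin m => R) j 1 = v
  have := h (u + v)
  rw [Matrix.mulVec_add, evalQF_add, evalQF_add, h, h] at this
  exact h2.mul_left_cancel (add_left_cancel this)

lemma evalQF_mulVec {m n : ℕ} (e : Fin n → R)
    (d : Fin m → R) (P : Matrix (Fin n) (Fin m) R)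
    (h : P.transpose * Matrix.diagonal e * P = Matrix.diagonal d) (u : Fin m → R) :
    evalQF e (P.mulVec u) = evalQF d u := by
  rw [← bil_self, bil_mulVec, h, ← bil_self]; rfl

lemma Isometric.refl {n : ℕ} (d : Fin n → R) : Isometric d d := ⟨LinearEquiv.refl _ _, fun _ => rfl⟩

lemma Isometric.trans {l m n : ℕ} {d : Fin l → R} {e : Fin m → R} {f : Fin n → R}
    (h : Isometric d e) (h' : Isometric e f) : Isometric d f := by
  obtain ⟨φ, hφ⟩ := h
  obtain ⟨ψ, hψ⟩ := h'
  exact ⟨φ.trans ψ, fun v => by simp [hφ, hψ]⟩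

lemma map_diagonal_bc {S : Type*} [CommRing S] (f : R →+* S) {n : ℕ} (d : Fin n → R) :
    (Matrix.diagonal d).map f = Matrix.diagonal (bc f d) := by
  rw [Matrix.diagonal_map (map_zero f)]; rfl

lemma map_transpose_mul_diagonal_mul {S : Type*} [CommRing S] (f : R →+* S) {m n : ℕ}
    (e : Fin n → R) (P Q : Matrix (Fin n) (Fin m) R) :
    (P.transpose * Matrix.diagonal e * Q).map f =
      (P.map f).transpose * Matrix.diagonal (bc f e) * Q.map f := by
  rw [Matrix.map_mul, Matrix.map_mul, map_diagonal_bc, Matrix.transpose_map]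

lemma Isometric.bc (h2 : IsUnit (2 : R)) {S : Type*} [CommRing S] (f : R →+* S) {m n : ℕ}
    {d : Fin m → R} {e : Fin n → R} (h : Isometric d e) :
    Isometric (QF.bc f d) (QF.bc f e) := by
  obtain ⟨φ, hφ⟩ := h
  set P := LinearMap.toMatrix' φ.toLinearMap with hP
  set Q := LinearMap.toMatrix' φ.symm.toLinearMap with hQ
  have hPQ : P * Q = 1 := by
    rw [hP, hQ, ← LinearMap.toMatrix'_comp]; simp
  have hQP : Q * P = 1 := by
    rw [hP, hQ, ← LinearMap.toMatrix'_comp]; simp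
  have hD := transpose_mul_diagonal_mul_eq h2 e d P fun u => by
    rw [hP, LinearMap.toMatrix'_mulVec]; exact hφ u
  have hD' := congrArg (fun M => Matrix.map M f) hD
  simp only [map_transpose_mul_diagonal_mul, map_diagonal_bc] at hD'
  refine ⟨Matrix.toLin'OfInv (M := Q.map f) (M' := P.map f) ?_ ?_, fun v => ?_⟩
  · rw [← Matrix.map_mul, hQP]; simp
  · rw [← Matrix.map_mul, hPQ]; simp
  · exact evalQF_mulVec _ _ _ hD' v

/-- A hyperbolic form has a totally isotropic direct summand of half the dimension. -/
lemma IsHyperbolic.exists_lagrangian [Nontrivial R] (h2 : IsUnit (2 : R)) {n : ℕ} {d : Fin n → R}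
    (h : IsHyperbolic d) :
    ∃ k : ℕ, n = k + k ∧ ∃ (G : Matrix (Fin n) (Fin k) R) (H : Matrix (Fin k) (Fin n) R),
      H * G = 1 ∧ G.transpose * Matrix.diagonal d * G = 0 := by
  obtain ⟨k, φ, hφ⟩ := h
  have hn : n = k + k := by
    have := φ.finrank_eq
    simpa using this
  let ι : (Fin k → R) →ₗ[R] (Fin (k + k) → R) :=
    { toFun := fun u => Fin.append u u
      map_add' := fun u v => by
        ext i
        refine Fin.addCases (fun i => ?_) (fun i => ?_) i <;>
          simp only [Fin.append_left, Fin.append_right, Pi.add_apply]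
      map_smul' := fun a v => by
        ext i
        refine Fin.addCases (fun i => ?_) (fun i => ?_) i <;>
          simp only [Fin.append_left, Fin.append_right, Pi.smul_apply, RingHom.id_apply] }
  let ρ : (Fin (k + k) → R) →ₗ[R] (Fin k → R) := LinearMap.funLeft R R (Fin.castAdd k)
  refine ⟨k, hn, LinearMap.toMatrix' (φ.symm.toLinearMap ∘ₗ ι),
    LinearMap.toMatrix' (ρ ∘ₗ φ.toLinearMap), ?_, ?_⟩
  · rw [← LinearMap.toMatrix'_comp, ← LinearMap.toMatrix'_id]
    congr 1
    ext u i
    simp [ρ, ι, LinearMap.funLeft_apply]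
  · rw [transpose_mul_diagonal_mul_eq h2 d 0 _ fun u => ?_]
    · exact Matrix.diagonal_zero
    rw [LinearMap.toMatrix'_mulVec, ← hφ]
    simp only [LinearMap.comp_apply, LinearEquiv.coe_coe, LinearEquiv.apply_symm_apply]
    simp only [evalQF, hypform, ι, Fin.sum_univ_add, LinearMap.coe_mk, AddHom.coe_mk,
      Fin.append_left, Fin.append_right, Pi.zero_apply, zero_mul, Finset.sum_const_zero]
    simp

end Basic

lemma pfisterOf_one {R : Type*} [CommRing R] (a : R) (s : Fin (2 ^ 1)) :
    pfisterOf (fun _ : Fin 1 => a) s = if s = 0 then 1 else a := by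
  have h : ∀ s : Fin (2 ^ 1), finFunctionFinEquiv.symm s (0 : Fin 1) = 0 ↔ s = 0 := by decide
  simp [pfisterOf, h]

/-- If `V` carries a skew-adjoint operator `J` with `J² = c ≠ 0`, then the anisotropic form on `V`
is a multiple of `⟨1, -c⟩`. -/
lemma exists_orthogonal_pairs {F : Type*} [Field F] {n : ℕ} {q : Fin n → F} (hqan : Anisotropic q)
    (hn : 0 < n) (J : (Fin n → F) →ₗ[F] (Fin n → F)) {c : F} (hc : c ≠ 0)
    (hskew : ∀ v w, bil q (J v) w = - bil q v (J w)) (halt : ∀ v, bil q v (J v) = 0)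
    (hJ : ∀ v, J (J v) = c • v) :
    ∃ (m : ℕ) (r : Fin m → F), 0 < m ∧ Nondeg r ∧
      Isometric q (tensorQF (pfisterOf (fun _ : Fin 1 => -c)) r) := by
  have hne : ∀ v, v ≠ 0 → bil q v v ≠ 0 := fun v hv h => hqan ⟨v, hv, by rwa [← bil_self]⟩
  have hJne : ∀ v, v ≠ 0 → J v ≠ 0 := fun v hv h => by
    have := hJ v
    rw [h, map_zero, eq_comm, smul_eq_zero] at this
    tauto
  have hJJ : ∀ v w, bil q (J v) (J w) = -c * bil q v w := fun v w => by
    rw [hskew, hJ, map_smul, smul_eq_mul, neg_mul]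
  let b : ∀ {m : ℕ}, (Fin m → Fin n → F) → Fin (2 ^ 1) × Fin m → Fin n → F :=
    fun w x => if x.1 = 0 then w x.2 else J (w x.2)
  let Good : ∀ {m : ℕ}, (Fin m → Fin n → F) → Prop := fun w =>
    (∀ i, w i ≠ 0) ∧ ∀ i j, i ≠ j → bil q (w i) (w j) = 0 ∧ bil q (w i) (J (w j)) = 0
  have hbne : ∀ {m : ℕ} (w : Fin m → Fin n → F), Good w → ∀ x, b w x ≠ 0 := by
    intro m w hw x
    simp only [b]
    split_ifs
    · exact hw.1 _
    · exact hJne _ (hw.1 _)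
  have hortho : ∀ {m : ℕ} (w : Fin m → Fin n → F), Good w →
      LinearMap.IsOrthoᵢ (bil q) (b w) := by
    rintro m w hw ⟨s, i⟩ ⟨t, j⟩ hij
    change bil q (b w (s, i)) (b w (t, j)) = 0
    by_cases h : i = j
    · subst h
      simp only [b]
      split_ifs with hs ht ht
      · simp_all
      · exact halt _
      · rw [bil_comm]; exact halt _
      · exact absurd (by rw [show s = t by omega]) hij
    · simp only [b]
      split_ifs with hs ht ht
      · exact (hw.2 _ _ h).1
      · exact (hw.2 _ _ h).2
      · rw [bil_comm]; exact (hw.2 _ _ (Ne.symm h)).2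
      · rw [hJJ, (hw.2 _ _ h).1, mul_zero]
  have hli : ∀ {m : ℕ} (w : Fin m → Fin n → F), Good w → LinearIndependent F (b w) :=
    fun w hw => LinearMap.linearIndependent_of_isOrthoᵢ (hortho w hw)
      fun x => hne _ (hbne w hw x)
  have hle : ∀ {m : ℕ} (w : Fin m → Fin n → F), Good w → 2 ^ 1 * m ≤ n := fun w hw => by
    simpa using (hli w hw).fintype_card_le_finrank
  have hext : ∀ {m : ℕ} (w : Fin m → Fin n → F), Good w → 2 ^ 1 * m < n →
      ∃ w' : Fin (m + 1) → Fin n → F, Good w' := by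
    intro m w hw hlt
    let f : (Fin n → F) →ₗ[F] (Fin (2 ^ 1) × Fin m → F) :=
      LinearMap.pi fun x => bil q (b w x)
    have hker : LinearMap.ker f ≠ ⊥ := LinearMap.ker_ne_bot_of_finrank_lt (by simpa using hlt)
    obtain ⟨x, hx, hx0⟩ := Submodule.exists_mem_ne_zero_of_ne_bot hker
    have hx' : ∀ y, bil q (b w y) x = 0 := fun y => congrFun hx y
    have h0 : ∀ i, bil q (w i) x = 0 := fun i => by simpa [b] using hx' (0, i)
    have h1 : ∀ i, bil q (w i) (J x) = 0 := fun i => by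
      have := hx' (1, i)
      simp only [b] at this
      rw [if_neg (by decide), hskew] at this
      simpa using this
    refine ⟨Fin.cons x w, fun i => ?_, fun i j hij => ?_⟩
    · refine Fin.cases ?_ (fun i => ?_) i
      · simpa using hx0
      · simpa using hw.1 i
    · revert hij
      refine Fin.cases ?_ (fun i => ?_) i <;> refine Fin.cases ?_ (fun j => ?_) j <;> intro hij
      · exact absurd rfl hij
      · refine ⟨by simpa [bil_comm q x] using h0 j, ?_⟩
        have := hskew x (w j)
        rw [bil_comm q (J x), h1] at this
        simpa using this.symm
      · exact ⟨by simpa using h0 i, by simpa using h1 i⟩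
      · simpa using hw.2 i j (fun h => hij (by rw [h]))
  obtain ⟨m, w, hw, hmn⟩ : ∃ (m : ℕ) (w : Fin m → Fin n → F), Good w ∧ 2 ^ 1 * m = n := by
    by_contra hcon
    push Not at hcon
    have : ∀ m : ℕ, ∃ w : Fin m → Fin n → F, Good w := by
      intro m
      induction m with
      | zero => exact ⟨fun i => i.elim0, fun i => i.elim0, fun i => i.elim0⟩
      | succ m ih =>
        obtain ⟨w, hw⟩ := ih
        exact hext w hw (lt_of_le_of_ne (hle w hw) (hcon m w hw))
    obtain ⟨w, hw⟩ := this (n + 1)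
    have := hle w hw
    omega
  subst hmn
  have hm : 0 < m := by omega
  have : Nonempty (Fin (2 ^ 1) × Fin m) := ⟨0, ⟨0, hm⟩⟩
  let B := basisOfLinearIndependentOfCardEqFinrank (hli w hw) (by simp)
  refine ⟨m, fun i => evalQF q (w i), hm, fun i => ?_, ?_⟩
  · change evalQF q (w i) ≠ 0
    rw [← bil_self]; exact hne _ (hw.1 i)
  · refine ⟨(B.reindex finProdFinEquiv).equivFun, fun v => ?_⟩
    have hv : v = ∑ x, B.equivFun v x • b w x := by
      conv_lhs => rw [← B.sum_equivFun v]
      simp [B]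
    have hcoef : ∀ x : Fin (2 ^ 1) × Fin m,
        bil q (b w x) (b w x) =
          tensorQF (pfisterOf (fun _ : Fin 1 => -c)) (fun i => evalQF q (w i))
            (finProdFinEquiv x) := by
      rintro ⟨s, i⟩
      simp only [tensorQF, Equiv.symm_apply_apply, pfisterOf_one, b]
      split_ifs with hs
      · rw [bil_self, one_mul]
      · rw [hJJ, bil_self]
    have hq : evalQF q v = ∑ x, B.equivFun v x ^ 2 * bil q (b w x) (b w x) := by
      rw [← bil_self]
      conv_lhs => rw [hv]
      simp only [map_sum, LinearMap.sum_apply, map_smul, LinearMap.smul_apply, smul_eq_mul]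
      refine Finset.sum_congr rfl fun x _ => ?_
      rw [Finset.sum_eq_single x]
      · ring
      · intro y _ hyx
        have : bil q (b w y) (b w x) = 0 := hortho w hw hyx
        simp [this]
      · simp
    rw [hq, evalQF, ← finProdFinEquiv.sum_comp]
    refine Finset.sum_congr rfl fun x _ => ?_
    rw [hcoef, mul_comm]
    simp

section Specialization

open Polynomial

variable {F : Type*} [Field F]

lemma evalQF_bc_eval {n : ℕ} (q : Fin n → F) (v : Fin n → F[X]) :
    evalQF q (fun i => (v i).eval 0) = (evalQF (bc C q) v).eval 0 := by
  simp [evalQF, bc, Polynomial.eval_finsetSum]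

/-- Values of an anisotropic form at polynomial vectors vanish to exactly twice the order to which
the vector vanishes. -/
lemma Anisotropic.X_pow_dvd {n : ℕ} {q : Fin n → F} (hq : Anisotropic q) (m : ℕ)
    (v : Fin n → F[X]) (h : X ^ (2 * m) ∣ evalQF (bc C q) v) (i : Fin n) : X ^ m ∣ v i := by
  induction m generalizing v with
  | zero => simp
  | succ m ih =>
    have h0 : (fun i => (v i).eval 0) = 0 := by
      by_contra hne
      refine hq ⟨_, hne, ?_⟩
      rw [evalQF_bc_eval, ← coeff_zero_eq_eval_zero, ← X_dvd_iff]
      exact (dvd_pow_self X (by omega)).trans h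
    have h1 : ∀ i, X ∣ v i := fun i => by
      rw [X_dvd_iff, coeff_zero_eq_eval_zero]
      exact congrFun h0 i
    choose w hw using h1
    obtain rfl : v = (X : F[X]) • w := funext hw
    rw [evalQF_smul, show 2 * (m + 1) = 2 + 2 * m by ring, pow_add] at h
    rw [pow_succ']
    exact mul_dvd_mul_left _ (ih w ((mul_dvd_mul_iff_left (pow_ne_zero 2 X_ne_zero)).1 h))

lemma Anisotropic.eq_zero_of_evalQF_bc_C {n : ℕ} {q : Fin n → F} (hq : Anisotropic q)
    (v : Fin n → F[X]) (h : evalQF (bc C q) v = 0) : v = 0 := by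
  funext i
  by_contra hne
  have := hq.X_pow_dvd ((v i).natDegree + 1) v (by simp [h]) i
  have := natDegree_le_of_dvd this hne
  simp at this

/-- A nonzero polynomial in several variables stays nonzero on a suitable curve through a given
point. -/
lemma exists_curve {r : ℕ} (c : Fin r → F) {s : MvPolynomial (Fin r) F} (hs : s ≠ 0) :
    ∃ σ : MvPolynomial (Fin r) F →ₐ[F] F[X], σ s ≠ 0 ∧
      ∀ p, (σ p).eval 0 = MvPolynomial.eval c p := by
  by_contra! hcon
  apply hs
  have hinj : Function.Injective (MvPolynomial.map (σ := Fin r) (C : F →+* F[X])) :=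
    MvPolynomial.map_injective _ C_injective
  apply hinj
  refine MvPolynomial.funext_set (fun i => {f : F[X] | f.eval 0 = c i}) (fun i => ?_) fun x hx => ?_
  · refine Set.infinite_of_injective_forall_mem (f := fun g : F[X] => C (c i) + X * g) ?_ ?_
    · intro g g' h
      exact mul_left_cancel₀ X_ne_zero (add_left_cancel h)
    · intro g; simp
  · by_contra hne
    obtain ⟨p, hp⟩ := hcon (MvPolynomial.aeval x) (by
      simpa [MvPolynomial.eval_map, MvPolynomial.aeval_def] using hne)
    apply hp
    have : ((Polynomial.aeval (0 : F)).comp (MvPolynomial.aeval x)) =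
        MvPolynomial.aeval (R := F) c := by
      ext i
      simpa using hx i (Set.mem_univ i)
    have := DFunLike.congr_fun this p
    rw [AlgHom.comp_apply, Polynomial.coe_aeval_eq_eval] at this
    exact this

lemma exists_common_denominator {A E ι : Type*} [CommRing A] [IsDomain A] [Field E] [Algebra A E]
    [IsFractionRing A E] [Finite ι] (f : ι → E) :
    ∃ (s : A) (g : ι → A), s ≠ 0 ∧ ∀ i, algebraMap A E (g i) = algebraMap A E s * f i := by
  have := Fintype.ofFinite ι
  obtain ⟨⟨s, hs⟩, h⟩ := IsLocalization.exist_integer_multiples_of_finite (nonZeroDivisors A) f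
  choose g hg using h
  refine ⟨s, g, nonZeroDivisors.ne_zero hs, fun i => ?_⟩
  rw [hg]
  exact Algebra.smul_def s (f i)

lemma bc_bc {R S T : Type*} [CommRing R] [CommRing S] [CommRing T] (f : R →+* S) (g : S →+* T)
    {n : ℕ} (d : Fin n → R) : bc g (bc f d) = bc (g.comp f) d := rfl

lemma map_evalQF {R S : Type*} [CommRing R] [CommRing S] (f : R →+* S) {n : ℕ}
    (d v : Fin n → R) : f (evalQF d v) = evalQF (bc f d) (fun i => f (v i)) := by
  simp [evalQF, bc]

lemma bc_algebraMap_tower {r : ℕ} {E : Type*} [Field E] [Algebra (MvPolynomial (Fin r) F) E]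
    [Algebra F E] [IsScalarTower F (MvPolynomial (Fin r) F) E]
    {n : ℕ} (q : Fin n → F) :
    bc (algebraMap F E) q =
      bc (algebraMap (MvPolynomial (Fin r) F) E)
        (bc (algebraMap F (MvPolynomial (Fin r) F)) q) := by
  rw [bc_bc, ← IsScalarTower.algebraMap_eq]

/-- Anisotropic forms remain anisotropic over rational function fields. -/
lemma Anisotropic.bc_fractionRing (r : ℕ) {E : Type*} [Field E] [Algebra (MvPolynomial (Fin r) F) E]
    [IsFractionRing (MvPolynomial (Fin r) F) E] [Algebra F E]
    [IsScalarTower F (MvPolynomial (Fin r) F) E]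
    {n : ℕ} {q : Fin n → F} (hq : Anisotropic q) :
    Anisotropic (bc (algebraMap F E) q) := by
  rintro ⟨v, hv, h⟩
  obtain ⟨s, u, hs, hu⟩ := exists_common_denominator (A := MvPolynomial (Fin r) F) v
  have hinj := IsFractionRing.injective (MvPolynomial (Fin r) F) E
  have hs' : algebraMap (MvPolynomial (Fin r) F) E s ≠ 0 := by
    rwa [Ne, map_eq_zero_iff _ hinj]
  have h0 : evalQF (bc (algebraMap F (MvPolynomial (Fin r) F)) q) u = 0 := by
    apply hinj
    rw [map_evalQF, ← bc_algebraMap_tower, map_zero, show (fun i => algebraMap _ E (u i)) =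
      algebraMap (MvPolynomial (Fin r) F) E s • v from funext hu, evalQF_smul, h, mul_zero]
  obtain ⟨i, hi⟩ := Function.ne_iff.1 hv
  have hui : u i ≠ 0 := by
    intro h
    have := hu i
    rw [h, map_zero, eq_comm, mul_eq_zero] at this
    exact this.elim hs' hi
  obtain ⟨σ, hσ, -⟩ := exists_curve (fun _ => (0 : F)) hui
  apply hσ
  have := congrArg σ.toRingHom h0
  rw [map_evalQF, bc_bc, map_zero] at this
  have hC : σ.toRingHom.comp (algebraMap F (MvPolynomial (Fin r) F)) = C :=
    σ.comp_algebraMap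
  rw [hC] at this
  exact congrFun (hq.eq_zero_of_evalQF_bc_C _ this) i

/-- A skew-adjoint similitude over a rational function field specializes at rational points. -/
lemma exists_specialization {r : ℕ} {E : Type*} [Field E] [Algebra (MvPolynomial (Fin r) F) E]
    [IsFractionRing (MvPolynomial (Fin r) F) E] [Algebra F E]
    [IsScalarTower F (MvPolynomial (Fin r) F) E]
    {n : ℕ} {q : Fin n → F} (hq : Anisotropic q) (c : Fin r → F)
    (e : MvPolynomial (Fin r) F) (J : Matrix (Fin n) (Fin n) E)
    (h₁ : J.transpose * Matrix.diagonal (bc (algebraMap F E) q) +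
      Matrix.diagonal (bc (algebraMap F E) q) * J = 0)
    (h₂ : J.transpose * Matrix.diagonal (bc (algebraMap F E) q) * J =
      -(algebraMap _ E e) • Matrix.diagonal (bc (algebraMap F E) q)) :
    ∃ (a : F) (N : Matrix (Fin n) (Fin n) F), a ≠ 0 ∧
      N.transpose * Matrix.diagonal q + Matrix.diagonal q * N = 0 ∧
      N.transpose * Matrix.diagonal q * N =
        -(a ^ 2 * MvPolynomial.eval c e) • Matrix.diagonal q := by
  obtain ⟨s, g, hs, hg⟩ := exists_common_denominator (A := MvPolynomial (Fin r) F)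
    (fun x : Fin n × Fin n => J x.1 x.2)
  have hinj := IsFractionRing.injective (MvPolynomial (Fin r) F) E
  let N : Matrix (Fin n) (Fin n) (MvPolynomial (Fin r) F) := Matrix.of fun i j => g (i, j)
  have hN : N.map (algebraMap (MvPolynomial (Fin r) F) E) =
      algebraMap (MvPolynomial (Fin r) F) E s • J := by
    ext i j; exact hg (i, j)
  set D : Matrix (Fin n) (Fin n) (MvPolynomial (Fin r) F) :=
    Matrix.diagonal (bc (algebraMap F (MvPolynomial (Fin r) F)) q) with hD
  have hDm : D.map (algebraMap (MvPolynomial (Fin r) F) E) =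
      Matrix.diagonal (bc (algebraMap F E) q) := by
    rw [hD, map_diagonal_bc, ← bc_algebraMap_tower]
  have hinjM : Function.Injective (fun M : Matrix (Fin n) (Fin n) (MvPolynomial (Fin r) F) =>
      M.map (algebraMap (MvPolynomial (Fin r) F) E)) :=
    Matrix.map_injective hinj
  have hN₁ : N.transpose * D + D * N = 0 := by
    apply hinjM
    simp only [Matrix.map_add _ (map_add _), Matrix.map_mul, Matrix.transpose_map, hN, hDm]
    rw [Matrix.transpose_smul, Matrix.smul_mul, Matrix.mul_smul, ← smul_add, h₁]
    simp
  have hN₂ : N.transpose * D * N = -(s ^ 2 * e) • D := by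
    apply hinjM
    simp only [Matrix.map_mul, Matrix.transpose_map, hN, hDm]
    rw [Matrix.transpose_smul, Matrix.smul_mul, Matrix.smul_mul, Matrix.mul_smul, h₂,
      Matrix.map_smul' _ _ _ (map_mul _), hDm, smul_smul, smul_smul]
    simp
    ring_nf
  obtain ⟨σ, hσ, hσc⟩ := exists_curve c hs
  have hC : σ.toRingHom.comp (algebraMap F (MvPolynomial (Fin r) F)) = C :=
    σ.comp_algebraMap
  have hDσ : D.map σ.toRingHom = Matrix.diagonal (bc C q) := by
    rw [hD, map_diagonal_bc, bc_bc, hC]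
  obtain ⟨u, hu, hu0⟩ := Polynomial.exists_eq_pow_rootMultiplicity_mul_and_not_dvd (σ s) hσ 0
  rw [C_0, sub_zero] at hu hu0
  rw [X_dvd_iff, coeff_zero_eq_eval_zero] at hu0
  set k := rootMultiplicity 0 (σ s)
  set M := N.map σ.toRingHom with hM
  have hinjX : ∀ {l : ℕ} {P Q : Matrix (Fin n) (Fin n) F[X]},
      (X ^ l : F[X]) • P = (X ^ l : F[X]) • Q → P = Q := fun h => by
    ext1 i j
    exact mul_left_cancel₀ (pow_ne_zero _ X_ne_zero) (congrFun (congrFun h i) j)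
  have hM₁ := congrArg (fun M => Matrix.map M σ.toRingHom) hN₁
  have hM₂ := congrArg (fun M => Matrix.map M σ.toRingHom) hN₂
  simp only [Matrix.map_add _ (map_add _), Matrix.map_mul, Matrix.transpose_map, hDσ, ← hM,
    Matrix.map_smul' _ _ _ (map_mul _)] at hM₁ hM₂
  have hσs : σ.toRingHom (-(s ^ 2 * e)) = X ^ (2 * k) * -(u ^ 2 * σ e) := by
    change σ (-(s ^ 2 * e)) = _
    rw [map_neg, map_mul, map_pow, hu]
    ring
  have hdvd : ∀ i j, X ^ k ∣ M i j := fun i j => by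
    refine hq.X_pow_dvd k (fun i => M i j) ?_ i
    rw [← bil_self, ← transpose_mul_diagonal_mul, hM₂, hσs, Matrix.smul_apply, smul_eq_mul,
      mul_assoc]
    exact dvd_mul_right _ _
  choose N' hN' using hdvd
  have hMN' : M = (X ^ k : F[X]) • Matrix.of N' := by
    ext1 i j; exact hN' i j
  have hN'₁ : (Matrix.of N').transpose * Matrix.diagonal (bc C q) +
      Matrix.diagonal (bc C q) * Matrix.of N' = 0 := by
    apply hinjX (l := k)
    rw [smul_add, ← Matrix.smul_mul, ← Matrix.mul_smul, ← Matrix.transpose_smul, ← hMN', hM₁]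
    ext i j
    simp
  have hN'₂ : (Matrix.of N').transpose * Matrix.diagonal (bc C q) * Matrix.of N' =
      -(u ^ 2 * σ e) • Matrix.diagonal (bc C q) := by
    apply hinjX (l := 2 * k)
    rw [smul_smul, ← hσs, ← hM₂, hMN', Matrix.transpose_smul, Matrix.smul_mul, Matrix.smul_mul,
      Matrix.mul_smul, smul_smul]
    ring_nf
  have hbc : bc (evalRingHom 0) (bc C q) = q := by
    funext i; simp [bc]
  refine ⟨u.eval 0, (Matrix.of N').map (evalRingHom 0), hu0, ?_, ?_⟩
  · have := congrArg (fun M => Matrix.map M (evalRingHom (0 : F))) hN'₁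
    simpa only [Matrix.map_add _ (map_add _), Matrix.map_mul, Matrix.transpose_map,
      map_diagonal_bc, hbc, Matrix.map_zero _ (map_zero _)] using this
  · have := congrArg (fun M => Matrix.map M (evalRingHom (0 : F))) hN'₂
    simp only [Matrix.map_mul, Matrix.transpose_map,
      map_diagonal_bc, hbc, Matrix.map_smul' _ _ _ (map_mul _)] at this
    rw [this, ← hσc]
    simp

end Specialization

section QuadraticExtension

open QuadraticAlgebra

lemma evalQF_quadraticAlgebra {E : Type*} [CommRing E] {e : E} {n : ℕ} (d : Fin n → E)
    (z : Fin n → QuadraticAlgebra E e 0) :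
    evalQF (bc (algebraMap E (QuadraticAlgebra E e 0)) d) z =
      ⟨evalQF d (fun i => (z i).re) + e * evalQF d (fun i => (z i).im),
        2 * bil d (fun i => (z i).re) (fun i => (z i).im)⟩ := by
  have hre : (evalQF (bc (algebraMap E (QuadraticAlgebra E e 0)) d) z).re =
      ∑ i, (d i * (z i).re ^ 2 + e * (d i * (z i).im ^ 2)) := by
    change reₗ e 0 _ = _
    rw [evalQF, map_sum]
    refine Finset.sum_congr rfl fun i _ => ?_
    simp [bc, pow_two]
    ring
  have him : (evalQF (bc (algebraMap E (QuadraticAlgebra E e 0)) d) z).im =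
      ∑ i, 2 * (d i * (z i).re * (z i).im) := by
    change imₗ e 0 _ = _
    rw [evalQF, map_sum]
    refine Finset.sum_congr rfl fun i _ => ?_
    simp [bc, pow_two]
    ring
  ext
  · rw [hre]
    simp only [evalQF, Finset.sum_add_distrib, Finset.mul_sum]
  · rw [him]
    simp only [bil_apply, Finset.mul_sum]

/-- An anisotropic form with a Lagrangian over the quadratic algebra `E[√e]` admits a skew-adjoint
similitude with factor `-e`. -/
lemma exists_similitude_of_lagrangian {E : Type*} [Field E] (h2 : (2 : E) ≠ 0) {e : E} {n k : ℕ}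
    (hn : 0 < n) {d : Fin n → E} (hd : Anisotropic d) (hk : n = k + k)
    (G : Matrix (Fin n) (Fin k) (QuadraticAlgebra E e 0))
    (H : Matrix (Fin k) (Fin n) (QuadraticAlgebra E e 0)) (hHG : H * G = 1)
    (hG : G.transpose * Matrix.diagonal
      (bc (algebraMap E (QuadraticAlgebra E e 0)) d) * G =
      (0 : Matrix (Fin k) (Fin k) (QuadraticAlgebra E e 0))) :
    e ≠ 0 ∧ ∃ J : Matrix (Fin n) (Fin n) E,
      J.transpose * Matrix.diagonal d + Matrix.diagonal d * J = 0 ∧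
      J.transpose * Matrix.diagonal d * J = -e • Matrix.diagonal d := by
  have han : ∀ v, evalQF d v = 0 → v = 0 := fun v h => by
    by_contra hv; exact hd ⟨v, hv, h⟩
  have hzero : ∀ u, evalQF (bc (algebraMap E (QuadraticAlgebra E e 0)) d) (G.mulVec u) = 0 := by
    intro u
    rw [evalQF_mulVec _ 0 _ (by rw [hG]; exact Matrix.diagonal_zero.symm)]
    simp [evalQF]
  have hq : ∀ u, evalQF d (fun i => (G.mulVec u i).re) =
      -e * evalQF d (fun i => (G.mulVec u i).im) := fun u => by
    have := congrArg QuadraticAlgebra.re (hzero u)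
    rw [evalQF_quadraticAlgebra] at this
    simp only [re_zero] at this
    linear_combination this
  have hb : ∀ u, bil d (fun i => (G.mulVec u i).re) (fun i => (G.mulVec u i).im) = 0 := fun u => by
    have := congrArg QuadraticAlgebra.im (hzero u)
    rw [evalQF_quadraticAlgebra] at this
    simpa [h2] using this
  have hGinj : ∀ u, G.mulVec u = 0 → u = 0 := fun u hu => by
    rw [← Matrix.one_mulVec u, ← hHG, ← Matrix.mulVec_mulVec, hu, Matrix.mulVec_zero]
  let S : (Fin k → QuadraticAlgebra E e 0) →ₗ[E] (Fin n → E) :=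
    (reₗ e 0).compLeft (Fin n) ∘ₗ G.mulVecLin.restrictScalars E
  let T : (Fin k → QuadraticAlgebra E e 0) →ₗ[E] (Fin n → E) :=
    (imₗ e 0).compLeft (Fin n) ∘ₗ G.mulVecLin.restrictScalars E
  have hTinj : Function.Injective T := by
    rw [injective_iff_map_eq_zero]
    intro u hu
    have him : (fun i => (G.mulVec u i).im) = 0 := hu
    have hre := han _ (by rw [hq u, him]; simp [evalQF])
    refine hGinj u (funext fun i => ?_)
    ext
    · exact congrFun hre i
    · exact congrFun him i
  let T' := LinearEquiv.ofInjectiveOfFinrankEq T hTinj (by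
    rw [Module.finrank_pi_fintype]
    simp [QuadraticAlgebra.finrank_eq_two]
    omega)
  have hT' : ∀ w, T (T'.symm w) = w := fun w => T'.apply_symm_apply w
  let J : (Fin n → E) →ₗ[E] (Fin n → E) := S ∘ₗ T'.symm.toLinearMap
  have hJq : ∀ w, evalQF d (J w) = -e * evalQF d w := fun w => by
    conv_rhs => rw [← hT' w]
    exact hq (T'.symm w)
  have hJb : ∀ w, bil d (J w) w = 0 := fun w => by
    conv_lhs => rw [← hT' w, hT']
    nth_rw 2 [← hT' w]
    exact hb (T'.symm w)
  refine ⟨?_, LinearMap.toMatrix' J, ?_, ?_⟩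
  · rintro rfl
    have hre : ∀ u, (fun i => (G.mulVec u i).re) = 0 := fun u => han _ (by rw [hq]; simp)
    have h0 := hGinj ((ω : QuadraticAlgebra E 0 0) • 1) (by
      funext i
      ext
      · exact congrFun (hre _) i
      · rw [Matrix.mulVec_smul]
        simpa using congrFun (hre 1) i)
    have := congrArg QuadraticAlgebra.im (congrFun h0 ⟨0, by omega⟩)
    simp at this
  · apply Matrix.toBilin'.injective
    rw [map_zero, map_add]
    refine LinearMap.ext₂ fun v w => ?_
    have h₁ := bil_mulVec d (LinearMap.toMatrix' J) 1 v w
    have h₂ := bil_mulVec d 1 (LinearMap.toMatrix' J) v w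
    simp only [Matrix.mul_one, Matrix.one_mul, Matrix.transpose_one, Matrix.one_mulVec,
      LinearMap.toMatrix'_mulVec] at h₁ h₂
    rw [LinearMap.add_apply, LinearMap.add_apply, ← h₁, ← h₂]
    have := hJb (v + w)
    rw [map_add, map_add, map_add, LinearMap.add_apply, LinearMap.add_apply, hJb, hJb] at this
    rw [bil_comm d v]
    change _ = (0 : E)
    linear_combination this
  · rw [transpose_mul_diagonal_mul_eq h2.isUnit d (-e • d)]
    · exact Matrix.diagonal_smul _ _
    · intro u
      rw [LinearMap.toMatrix'_mulVec, hJq]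
      simp [evalQF, Finset.mul_sum, mul_assoc]

end QuadraticExtension

section FunctionField

open QuadraticAlgebra

variable {F : Type*} [Field F]

/-- The ring homomorphism on `A[√e]` extending `ι` and sending `√e` to `x`. -/
def liftSqrt {A B : Type*} [CommRing A] [CommRing B] (ι : A →+* B) {e : A} (x : B)
    (hx : x ^ 2 = ι e) : QuadraticAlgebra A e 0 →+* B where
  toFun z := ι z.re + ι z.im * x
  map_one' := by simp
  map_mul' z w := by
    simp only [re_mul, im_mul, map_add, map_mul, map_zero]
    linear_combination -(ι z.im * ι w.im) * hx
  map_zero' := by simp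
  map_add' z w := by
    simp only [re_add, im_add, map_add]
    ring

lemma liftSqrt_algebraMap {A B : Type*} [CommRing A] [CommRing B] (ι : A →+* B) {e : A} (x : B)
    (hx : x ^ 2 = ι e) (a : A) : liftSqrt ι x hx (algebraMap A _ a) = ι a := by
  simp [liftSqrt]

lemma liftSqrt_omega {A B : Type*} [CommRing A] [CommRing B] (ι : A →+* B) {e : A} (x : B)
    (hx : x ^ 2 = ι e) : liftSqrt ι x hx ω = x := by
  simp [liftSqrt]

/-- The polynomial `e` with `X₀² = e` on the quadric `p = 0`. -/
noncomputable def radicand {r : ℕ} (p : Fin (r + 1) → F) : MvPolynomial (Fin r) F :=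
  ∑ i, MvPolynomial.C (-p i.succ / p 0) * MvPolynomial.X i ^ 2

lemma formPoly_succ {r : ℕ} (p : Fin (r + 1) → F) (hp : p 0 ≠ 0) :
    formPoly p = MvPolynomial.C (p 0) *
      (MvPolynomial.X 0 ^ 2 - MvPolynomial.rename Fin.succ (radicand p)) := by
  have h : ∀ i : Fin r, MvPolynomial.C (σ := Fin (r + 1)) (p 0) * MvPolynomial.C (-p i.succ / p 0) =
      -MvPolynomial.C (p i.succ) := fun i => by
    rw [← map_mul, mul_div_cancel₀ _ hp, map_neg]
  simp only [formPoly, radicand, Fin.sum_univ_succ, map_sum, map_mul, map_pow,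
    MvPolynomial.rename_C, MvPolynomial.rename_X, mul_sub, Finset.mul_sum, ← mul_assoc, h,
    neg_mul, Finset.sum_neg_distrib, sub_neg_eq_add]

/-- Evaluation of polynomials at the generic point `(ω, X₁, …, Xᵣ)` of the quadric. -/
noncomputable def evalQuadratic {r : ℕ} (p : Fin (r + 1) → F) :
    MvPolynomial (Fin (r + 1)) F →ₐ[F] QuadraticAlgebra (MvPolynomial (Fin r) F) (radicand p) 0 :=
  MvPolynomial.aeval (Fin.cons ω fun i => algebraMap (MvPolynomial (Fin r) F) _ (MvPolynomial.X i))

lemma evalQuadratic_X_zero {r : ℕ} (p : Fin (r + 1) → F) :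
    evalQuadratic p (MvPolynomial.X 0) = ω := by
  simp [evalQuadratic]

lemma evalQuadratic_rename {r : ℕ} (p : Fin (r + 1) → F) (g : MvPolynomial (Fin r) F) :
    evalQuadratic p (MvPolynomial.rename Fin.succ g) = algebraMap _ _ g := by
  rw [evalQuadratic, MvPolynomial.aeval_rename]
  have : (Fin.cons ω fun i => algebraMap (MvPolynomial (Fin r) F)
      (QuadraticAlgebra (MvPolynomial (Fin r) F) (radicand p) 0) (MvPolynomial.X i) :
        Fin (r + 1) → QuadraticAlgebra (MvPolynomial (Fin r) F) (radicand p) 0) ∘ Fin.succ =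
        fun i => algebraMap (MvPolynomial (Fin r) F) _ (MvPolynomial.X i) := by
    funext i; simp
  rw [this]
  refine (MvPolynomial.aeval_algebraMap_apply _ (MvPolynomial.X : Fin r → _) g).trans ?_
  rw [MvPolynomial.aeval_X_left, AlgHom.id_apply]

lemma evalQuadratic_formPoly {r : ℕ} (p : Fin (r + 1) → F) (hp : p 0 ≠ 0) :
    evalQuadratic p (formPoly p) = 0 := by
  rw [formPoly_succ p hp, map_mul, map_sub, evalQuadratic_rename, map_pow, evalQuadratic_X_zero,
    pow_two, omega_mul_omega_eq_algebraMap, map_zero, zero_mul, add_zero, sub_self, mul_zero]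

/-- The comparison of the coordinate ring of a quadric with a quadratic algebra over a polynomial
ring. -/
noncomputable def coordRingToQuadratic {r : ℕ} (p : Fin (r + 1) → F) (hp : p 0 ≠ 0) :
    CoordRing p →ₐ[F] QuadraticAlgebra (MvPolynomial (Fin r) F) (radicand p) 0 :=
  Ideal.Quotient.liftₐ _ (evalQuadratic p) fun a ha => by
    obtain ⟨b, rfl⟩ := Ideal.mem_span_singleton'.1 ha
    rw [map_mul, evalQuadratic_formPoly p hp, mul_zero]

lemma coordRingToQuadratic_mk {r : ℕ} (p : Fin (r + 1) → F) (hp : p 0 ≠ 0)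
    (g : MvPolynomial (Fin (r + 1)) F) :
    coordRingToQuadratic p hp (Ideal.Quotient.mk _ g) = evalQuadratic p g := rfl

lemma coordRingToQuadratic_surjective {r : ℕ} (p : Fin (r + 1) → F) (hp : p 0 ≠ 0) :
    Function.Surjective (coordRingToQuadratic p hp) := fun z =>
  ⟨Ideal.Quotient.mk _ (MvPolynomial.rename Fin.succ z.re +
    MvPolynomial.rename Fin.succ z.im * MvPolynomial.X 0), by
      rw [coordRingToQuadratic_mk, map_add, map_mul, evalQuadratic_rename, evalQuadratic_rename,
        evalQuadratic_X_zero]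
      ext <;> simp⟩

lemma mk_X_zero_sq {r : ℕ} (p : Fin (r + 1) → F) (hp : p 0 ≠ 0) :
    (Ideal.Quotient.mk (Ideal.span {formPoly p}) (MvPolynomial.X 0)) ^ 2 =
      Ideal.Quotient.mk _ (MvPolynomial.rename Fin.succ (radicand p)) := by
  rw [← map_pow, Ideal.Quotient.mk_eq_mk_iff_sub_mem, Ideal.mem_span_singleton']
  refine ⟨MvPolynomial.C (p 0)⁻¹, ?_⟩
  rw [formPoly_succ p hp, ← mul_assoc, ← map_mul, inv_mul_cancel₀ hp, map_one, one_mul]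

lemma coordRingToQuadratic_injective {r : ℕ} (p : Fin (r + 1) → F) (hp : p 0 ≠ 0) :
    Function.Injective (coordRingToQuadratic p hp) := by
  let ι : MvPolynomial (Fin r) F →+* CoordRing p :=
    (Ideal.Quotient.mk _).comp (MvPolynomial.rename Fin.succ).toRingHom
  let ψ := liftSqrt ι _ (mk_X_zero_sq p hp)
  have hψ : ψ.comp (coordRingToQuadratic p hp).toRingHom = RingHom.id _ := by
    refine Ideal.Quotient.ringHom_ext (MvPolynomial.ringHom_ext (fun a => ?_) fun i => ?_)
    · change ψ (coordRingToQuadratic p hp (Ideal.Quotient.mk _ (MvPolynomial.C a))) =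
        Ideal.Quotient.mk _ (MvPolynomial.C a)
      rw [coordRingToQuadratic_mk, ← MvPolynomial.rename_C Fin.succ a, evalQuadratic_rename]
      exact liftSqrt_algebraMap _ _ _ _
    · change ψ (coordRingToQuadratic p hp (Ideal.Quotient.mk _ (MvPolynomial.X i))) =
        Ideal.Quotient.mk _ (MvPolynomial.X i)
      rw [coordRingToQuadratic_mk]
      refine Fin.cases ?_ (fun i => ?_) i
      · rw [evalQuadratic_X_zero]
        exact liftSqrt_omega _ _ _
      · rw [← MvPolynomial.rename_X Fin.succ i, evalQuadratic_rename]
        exact liftSqrt_algebraMap _ _ _ _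
  exact Function.LeftInverse.injective (g := ψ) fun x => RingHom.congr_fun hψ x

/-- Base change of quadratic algebras. -/
def quadraticMap {A E : Type*} [CommRing A] [CommRing E] (f : A →+* E) (e : A) :
    QuadraticAlgebra A e 0 →+* QuadraticAlgebra E (f e) 0 :=
  liftSqrt ((algebraMap E _).comp f) ω (by
    rw [pow_two, omega_mul_omega_eq_algebraMap, map_zero, zero_mul, add_zero, RingHom.comp_apply])

lemma norm_quadraticMap {A E : Type*} [CommRing A] [CommRing E] (f : A →+* E) (e : A)
    (z : QuadraticAlgebra A e 0) : norm (quadraticMap f e z) = f (norm z) := by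
  simp [quadraticMap, liftSqrt, norm_def]

/-- The function field of a quadric maps to a quadratic algebra over a rational function field. -/
lemma exists_funField_hom {r : ℕ} {E : Type*} [Field E] [Algebra (MvPolynomial (Fin r) F) E]
    [IsFractionRing (MvPolynomial (Fin r) F) E] [Algebra F E]
    [IsScalarTower F (MvPolynomial (Fin r) F) E] (p : Fin (r + 1) → F) (hp : p 0 ≠ 0) :
    ∃ Θ : FunField p →+* QuadraticAlgebra E (algebraMap _ E (radicand p)) 0,
      Θ.comp (algebraMap F (FunField p)) =
        (algebraMap E (QuadraticAlgebra E (algebraMap _ E (radicand p)) 0)).comp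
          (algebraMap F E) := by
  let g : CoordRing p →+* QuadraticAlgebra E (algebraMap _ E (radicand p)) 0 :=
    (quadraticMap (algebraMap _ E) (radicand p)).comp (coordRingToQuadratic p hp).toRingHom
  have hg : ∀ y : nonZeroDivisors (CoordRing p), IsUnit (g y) := fun y => by
    have h₁ : coordRingToQuadratic p hp y ∈ nonZeroDivisors _ := by
      refine mem_nonZeroDivisors_iff_right.2 fun z hz => ?_
      obtain ⟨w, rfl⟩ := coordRingToQuadratic_surjective p hp z
      rw [← map_mul, map_eq_zero_iff _ (coordRingToQuadratic_injective p hp)] at hz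
      rw [mem_nonZeroDivisors_iff_right.1 y.2 w hz, map_zero]
    rw [isUnit_iff_norm_isUnit]
    change IsUnit (norm (quadraticMap _ _ (coordRingToQuadratic p hp y)))
    rw [norm_quadraticMap, isUnit_iff_ne_zero,
      map_ne_zero_iff _ (IsFractionRing.injective (MvPolynomial (Fin r) F) E)]
    exact nonZeroDivisors.ne_zero (norm_mem_nonZeroDivisors_iff.2 h₁)
  refine ⟨IsLocalization.lift hg, ?_⟩
  rw [IsScalarTower.algebraMap_eq F (CoordRing p) (FunField p), ← RingHom.comp_assoc,
    IsLocalization.lift_comp]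
  ext1 a
  change quadraticMap _ _ (coordRingToQuadratic p hp (algebraMap F _ a)) =
    algebraMap E _ (algebraMap F E a)
  rw [AlgHom.commutes, IsScalarTower.algebraMap_apply F (MvPolynomial (Fin r) F), quadraticMap,
    liftSqrt_algebraMap, RingHom.comp_apply,
    IsScalarTower.algebraMap_apply F (MvPolynomial (Fin r) F) E]

end FunctionField

section PfisterMultiples

lemma Isometric.tensorQF {R : Type*} [CommRing R] {m m' n : ℕ} {d : Fin m → R} {d' : Fin m' → R}
    (h : Isometric d d') (r : Fin n → R) :
    Isometric (tensorQF d r) (tensorQF d' r) := by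
  obtain ⟨φ, hφ⟩ := h
  have hval : ∀ {l : ℕ} (c : Fin l → R) (w : Fin (l * n) → R),
      evalQF (QF.tensorQF c r) w = ∑ j, r j * evalQF c fun i => w (finProdFinEquiv (i, j)) := by
    intro l c w
    simp only [evalQF, QF.tensorQF, ← finProdFinEquiv.sum_comp, Equiv.symm_apply_apply,
      Fintype.sum_prod_type_right, Finset.mul_sum]
    exact Finset.sum_congr rfl fun j _ => Finset.sum_congr rfl fun i _ => by ring
  let f : ∀ {l l' : ℕ}, ((Fin l → R) →ₗ[R] (Fin l' → R)) →
      ((Fin (l * n) → R) →ₗ[R] (Fin (l' * n) → R)) := fun φ =>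
    LinearMap.pi fun x => LinearMap.proj (finProdFinEquiv.symm x).1 ∘ₗ φ ∘ₗ
      LinearMap.funLeft R R fun i => finProdFinEquiv (i, (finProdFinEquiv.symm x).2)
  have hf : ∀ {l l' : ℕ} (φ : (Fin l → R) →ₗ[R] (Fin l' → R)) (w : Fin (l * n) → R) (i : Fin l')
      (j : Fin n), f φ w (finProdFinEquiv (i, j)) = φ (fun i => w (finProdFinEquiv (i, j))) i := by
    intro l l' φ w i j
    simp only [f, LinearMap.pi_apply, LinearMap.comp_apply, LinearMap.proj_apply,
      Equiv.symm_apply_apply]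
    rfl
  have hinv : ∀ {l l' : ℕ} (φ : (Fin l → R) ≃ₗ[R] (Fin l' → R)) (w : Fin (l * n) → R),
      f φ.symm.toLinearMap (f φ.toLinearMap w) = w := by
    intro l l' φ w
    funext x
    obtain ⟨⟨i, j⟩, rfl⟩ := finProdFinEquiv.surjective x
    rw [hf]
    simp only [hf, LinearEquiv.coe_coe]
    exact congrFun (φ.symm_apply_apply fun i => w (finProdFinEquiv (i, j))) i
  refine ⟨LinearEquiv.ofLinearMap (f φ.toLinearMap) (f φ.symm.toLinearMap)
    (LinearMap.ext fun w => by simpa using hinv φ.symm w)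
    (LinearMap.ext fun w => hinv φ w), fun w => ?_⟩
  rw [hval, hval]
  refine Finset.sum_congr rfl fun j _ => ?_
  rw [← hφ]
  congr 2
  funext i
  exact hf _ _ _ _

/-- A multiple of `⟨1, a⟩` is hyperbolic as soon as `-a` is a square. -/
lemma isHyperbolic_of_sq {R : Type*} [CommRing R] (h2 : IsUnit (2 : R)) {a i : R} (ha : IsUnit a)
    (hi : i ^ 2 = -a) {N k : ℕ} {d : Fin N → R} (hd : ∀ x, IsUnit (d x))
    (ε : Fin N ≃ Fin k ⊕ Fin k)
    (hε : ∀ x, d (ε.symm (Sum.inr x)) = a * d (ε.symm (Sum.inl x))) :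
    IsHyperbolic d := by
  obtain ⟨t, ht⟩ := h2.exists_right_inv
  obtain ⟨b, hb⟩ := ha.exists_right_inv
  choose u hu using fun x => (hd x).exists_right_inv
  let c : Fin k → R := fun x => d (ε.symm (Sum.inl x))
  let c' : Fin k → R := fun x => u (ε.symm (Sum.inl x))
  have hc : ∀ x, c x * c' x = 1 := fun x => hu _
  let f : (Fin N → R) →ₗ[R] (Fin (k + k) → R) :=
    LinearMap.pi (Fin.append
      (fun x => t • ((c x + 1) • LinearMap.proj (ε.symm (Sum.inl x)) +
        (i * (1 - c x)) • LinearMap.proj (ε.symm (Sum.inr x))))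
      (fun x => t • ((c x - 1) • LinearMap.proj (ε.symm (Sum.inl x)) -
        (i * (1 + c x)) • LinearMap.proj (ε.symm (Sum.inr x)))))
  let g : (Fin (k + k) → R) →ₗ[R] (Fin N → R) :=
    LinearMap.pi fun y => Sum.elim
      (fun x => t • ((c' x + 1) • LinearMap.proj (Fin.castAdd k x) +
        (c' x - 1) • LinearMap.proj (Fin.natAdd k x)))
      (fun x => (t * (b * i)) • ((c' x - 1) • LinearMap.proj (Fin.castAdd k x) +
        (c' x + 1) • LinearMap.proj (Fin.natAdd k x))) (ε y)
  have hfl : ∀ w x, f w (Fin.castAdd k x) =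
      t * ((c x + 1) * w (ε.symm (Sum.inl x)) + i * (1 - c x) * w (ε.symm (Sum.inr x))) := by
    intro w x
    simp only [f, LinearMap.pi_apply, Fin.append_left]
    rfl
  have hfr : ∀ w x, f w (Fin.natAdd k x) =
      t * ((c x - 1) * w (ε.symm (Sum.inl x)) - i * (1 + c x) * w (ε.symm (Sum.inr x))) := by
    intro w x
    simp only [f, LinearMap.pi_apply, Fin.append_right]
    rfl
  have hgl : ∀ w x, g w (ε.symm (Sum.inl x)) =
      t * ((c' x + 1) * w (Fin.castAdd k x) + (c' x - 1) * w (Fin.natAdd k x)) := by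
    intro w x
    simp only [g, LinearMap.pi_apply, Equiv.apply_symm_apply]
    rfl
  have hgr : ∀ w x, g w (ε.symm (Sum.inr x)) =
      t * (b * i) * ((c' x - 1) * w (Fin.castAdd k x) + (c' x + 1) * w (Fin.natAdd k x)) := by
    intro w x
    simp only [g, LinearMap.pi_apply, Equiv.apply_symm_apply]
    rfl
  have hbi : b * i ^ 2 = -1 := by linear_combination b * hi - hb
  refine ⟨k, LinearEquiv.ofLinearMap f g (LinearMap.ext fun w => funext fun y => ?_)
    (LinearMap.ext fun w => funext fun y => ?_), fun w => ?_⟩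
  · rw [LinearMap.comp_apply, LinearMap.id_apply]
    refine Fin.addCases (fun x => ?_) (fun x => ?_) y
    · rw [hfl, hgl, hgr]
      linear_combination t ^ 2 * (1 - c x) * ((c' x - 1) * w (Fin.castAdd k x) +
        (c' x + 1) * w (Fin.natAdd k x)) * hbi +
        2 * t ^ 2 * (w (Fin.castAdd k x) + w (Fin.natAdd k x)) * hc x +
        (2 * t + 1) * w (Fin.castAdd k x) * ht
    · rw [hfr, hgl, hgr]
      linear_combination -t ^ 2 * (1 + c x) * ((c' x - 1) * w (Fin.castAdd k x) +
        (c' x + 1) * w (Fin.natAdd k x)) * hbi +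
        2 * t ^ 2 * (w (Fin.castAdd k x) + w (Fin.natAdd k x)) * hc x +
        (2 * t + 1) * w (Fin.natAdd k x) * ht
  · rw [LinearMap.comp_apply, LinearMap.id_apply]
    obtain ⟨x | x, rfl⟩ := ε.symm.surjective y
    · rw [hgl, hfl, hfr]
      linear_combination 2 * t ^ 2 * (w (ε.symm (Sum.inl x)) - i * w (ε.symm (Sum.inr x))) * hc x +
        (2 * t + 1) * w (ε.symm (Sum.inl x)) * ht
    · rw [hgr, hfl, hfr]
      linear_combination 2 * t ^ 2 * (b * i * w (ε.symm (Sum.inl x)) -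
        b * i ^ 2 * w (ε.symm (Sum.inr x))) * hc x -
        4 * t ^ 2 * w (ε.symm (Sum.inr x)) * hbi + (2 * t + 1) * w (ε.symm (Sum.inr x)) * ht
  · change evalQF (hypform k) (f w) = _
    simp only [evalQF, hypform, Fin.sum_univ_add, Fin.append_left, Fin.append_right]
    rw [← ε.symm.sum_comp, Fintype.sum_sum_type, ← Finset.sum_add_distrib,
      ← Finset.sum_add_distrib]
    refine Finset.sum_congr rfl fun x _ => ?_
    rw [hfl, hfr, hε]
    change _ = c x * _ + a * c x * _
    linear_combination (2 * t + 1) * c x * (w (ε.symm (Sum.inl x)) ^ 2 -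
      i ^ 2 * w (ε.symm (Sum.inr x)) ^ 2) * ht - c x * w (ε.symm (Sum.inr x)) ^ 2 * hi

lemma exists_split_equiv {R : Type*} [CommRing R] {n mr : ℕ} (a : Fin (n + 1) → R)
    (r : Fin mr → R) :
    ∃ (k : ℕ) (ε : Fin (2 ^ (n + 1) * mr) ≃ Fin k ⊕ Fin k),
      ∀ x, tensorQF (pfisterOf a) r (ε.symm (Sum.inr x)) =
        a 0 * tensorQF (pfisterOf a) r (ε.symm (Sum.inl x)) := by
  let K := (Fin n → Fin 2) × Fin mr
  let κ : Fin (Fintype.card K) ≃ K := (Fintype.equivFin K).symm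
  let η : Fin 2 × K ≃ Fin (2 ^ (n + 1) * mr) :=
    (Equiv.prodAssoc _ _ _).symm.trans ((Equiv.prodCongr
      ((Fin.consEquiv fun _ : Fin (n + 1) => Fin 2).trans finFunctionFinEquiv)
      (Equiv.refl _)).trans finProdFinEquiv)
  let θ : Fin (Fintype.card K) ⊕ Fin (Fintype.card K) ≃ Fin 2 × K :=
    (Equiv.sumCongr κ κ).trans ((Equiv.boolProdEquivSum K).symm.trans
      (Equiv.prodCongr finTwoEquiv.symm (Equiv.refl _)))
  refine ⟨Fintype.card K, (θ.trans η).symm, fun x => ?_⟩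
  have h : ∀ y, tensorQF (pfisterOf a) r (η y) =
      (if y.1 = 0 then 1 else a 0) *
        ((∏ j : Fin n, if y.2.1 j = 0 then 1 else a j.succ) * r y.2.2) := by
    rintro ⟨s, v, j⟩
    simp [η, tensorQF, pfisterOf, Fin.prod_univ_succ, Fin.consEquiv, mul_assoc]
    rfl
  simp only [Equiv.symm_symm, Equiv.trans_apply, h]
  simp [θ, finTwoEquiv]

end PfisterMultiples

/-- Anisotropic forms that become hyperbolic over the function field of a quadric are multiples
of a one-fold Pfister form. -/
lemma exists_isometric_of_isHyperbolic {F : Type*} [Field F] (h2 : (2 : F) ≠ 0)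
    {nq : ℕ} {q : Fin nq → F} (hq : Nondeg q) (hq0 : 0 < nq) (hqan : Anisotropic q)
    {r : ℕ} (p : Fin (r + 1) → F) (hp : Nondeg p)
    (h : IsHyperbolic (bc (algebraMap F (FunField p)) q)) :
    ∃ (c : F) (m : ℕ) (s : Fin m → F), c ≠ 0 ∧ 0 < m ∧ Nondeg s ∧
      Isometric q (tensorQF (pfisterOf (fun _ : Fin 1 => -c)) s) := by
  let A := MvPolynomial (Fin r) F
  let E := FractionRing A
  let e := radicand p
  have h2E : (2 : E) ≠ 0 := by
    have := (map_ne_zero (algebraMap F E)).2 h2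
    rwa [map_ofNat] at this
  obtain ⟨Θ, hΘ⟩ := exists_funField_hom (E := E) p (hp 0)
  have : Nontrivial (FunField p) := Θ.domain_nontrivial
  have h2L : IsUnit (2 : FunField p) := by
    have := h2.isUnit.map (algebraMap F (FunField p))
    rwa [map_ofNat] at this
  obtain ⟨k, hk, G, H, hHG, hG⟩ := h.exists_lagrangian h2L
  have hHG' : H.map Θ * G.map Θ = 1 := by
    rw [← Matrix.map_mul, hHG]; simp
  have hG' := congrArg (fun M => Matrix.map M Θ) hG
  simp only [map_transpose_mul_diagonal_mul] at hG'
  rw [bc_bc, hΘ, ← bc_bc, Matrix.map_zero _ (map_zero Θ)] at hG'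
  obtain ⟨he, J, hJ₁, hJ₂⟩ := exists_similitude_of_lagrangian h2E hq0
    (hqan.bc_fractionRing r (E := E)) hk _ _ hHG' hG'
  have hr : 0 < r := by
    rcases r with _ | r
    · exact absurd (by simp [radicand]) he
    · exact Nat.succ_pos r
  let c : Fin r → F := Pi.single ⟨0, hr⟩ 1
  obtain ⟨a, N, ha, hN₁, hN₂⟩ := exists_specialization hqan c e J hJ₁ hJ₂
  have hec : MvPolynomial.eval c e ≠ 0 := by
    have : MvPolynomial.eval c e = -p (Fin.succ ⟨0, hr⟩) / p 0 := by
      simp only [e, radicand, map_sum, map_mul, map_pow, MvPolynomial.eval_C, MvPolynomial.eval_X]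
      rw [Finset.sum_eq_single ⟨0, hr⟩]
      · simp [c]
      · intro i _ hi
        simp [c, hi]
      · simp
    rw [this]
    exact div_ne_zero (neg_ne_zero.2 (hp _)) (hp _)
  set γ := a ^ 2 * MvPolynomial.eval c e with hγ
  have hγ0 : γ ≠ 0 := mul_ne_zero (pow_ne_zero 2 ha) hec
  have hNN : N * N = γ • (1 : Matrix (Fin nq) (Fin nq) F) := by
    have hDu : IsUnit (Matrix.diagonal q) := by
      rw [Matrix.isUnit_iff_isUnit_det, Matrix.det_diagonal, isUnit_iff_ne_zero]
      exact Finset.prod_ne_zero_iff.2 fun i _ => hq i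
    apply hDu.mul_left_cancel
    rw [eq_neg_of_add_eq_zero_left hN₁] at hN₂
    rw [← Matrix.mul_assoc, Matrix.mul_smul, Matrix.mul_one, ← neg_inj, ← Matrix.neg_mul, hN₂,
      neg_smul]
  have hskew : ∀ v w, bil q (N.toLin' v) w = -bil q v (N.toLin' w) := by
    intro v w
    have h₁ := bil_mulVec q N 1 v w
    have h₂ := bil_mulVec q 1 N v w
    simp only [Matrix.mul_one, Matrix.one_mul, Matrix.transpose_one, Matrix.one_mulVec] at h₁ h₂
    rw [Matrix.toLin'_apply, Matrix.toLin'_apply, h₁, h₂, eq_neg_of_add_eq_zero_left hN₁, map_neg]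
    rfl
  obtain ⟨m, s, hm, hs, hiso⟩ := exists_orthogonal_pairs hqan hq0 N.toLin' hγ0 hskew
    (fun v => by
      have := hskew v v
      rw [bil_comm, eq_neg_iff_add_eq_zero, ← two_mul] at this
      exact (mul_eq_zero.1 this).resolve_left h2)
    (fun v => by
      rw [Matrix.toLin'_apply, Matrix.toLin'_apply, Matrix.mulVec_mulVec, hNN, Matrix.smul_mulVec,
        Matrix.one_mulVec])
  exact ⟨γ, m, s, hγ0, hm, hs, hiso⟩

/-- Over the function field of `⟨1, a⟩` the element `-a` becomes a square. -/
lemma exists_sq_funField {F : Type*} [Field F] (a : F) :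
    ∃ i : FunField ![1, a], i ^ 2 = -algebraMap F _ a := by
  have hp : (![1, a] : Fin (1 + 1) → F) 0 ≠ 0 := one_ne_zero
  let x : CoordRing ![1, a] := Ideal.Quotient.mk _ (MvPolynomial.X 0)
  let y : CoordRing ![1, a] := Ideal.Quotient.mk _ (MvPolynomial.X 1)
  have hxy : x ^ 2 = -algebraMap F _ a * y ^ 2 := by
    refine (mk_X_zero_sq (r := 1) ![1, a] hp).trans ?_
    have : MvPolynomial.rename Fin.succ (radicand (r := 1) ![1, a]) =
        -MvPolynomial.C a * MvPolynomial.X 1 ^ 2 := by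
      simp [radicand]
    rw [this, map_mul, map_neg, map_pow]
    rfl
  have hy : y ∈ nonZeroDivisors (CoordRing ![1, a]) := by
    apply comap_nonZeroDivisors_le_of_injective (coordRingToQuadratic_injective (r := 1) ![1, a] hp)
    have : coordRingToQuadratic (r := 1) ![1, a] hp y =
        algebraMap _ _ (MvPolynomial.X 0 : MvPolynomial (Fin 1) F) := by
      refine (coordRingToQuadratic_mk (r := 1) _ hp _).trans ?_
      rw [show (MvPolynomial.X 1 : MvPolynomial (Fin (1 + 1)) F) =
        MvPolynomial.rename Fin.succ (MvPolynomial.X 0) by simp, evalQuadratic_rename]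
    rw [Submonoid.mem_comap, this, QuadraticAlgebra.algebraMap_mem_nonZeroDivisors_iff]
    exact mem_nonZeroDivisors_of_ne_zero (MvPolynomial.X_ne_zero 0)
  obtain ⟨z, hz⟩ := (IsLocalization.map_units (FunField ![1, a]) ⟨y, hy⟩).exists_right_inv
  refine ⟨algebraMap _ _ x * z, ?_⟩
  rw [mul_pow, ← map_pow, hxy, map_mul, map_neg, map_pow, ← IsScalarTower.algebraMap_apply,
    mul_assoc, ← mul_pow]
  change -_ * (_ : FunField ![1, a]) ^ 2 = _
  rw [hz, one_pow, mul_one]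

lemma isUnit_tensorQF {R : Type*} [CommRing R] {m n : ℕ} {d : Fin m → R} {e : Fin n → R}
    (hd : ∀ i, IsUnit (d i)) (he : ∀ i, IsUnit (e i)) (i : Fin (m * n)) :
    IsUnit (tensorQF d e i) := (hd _).mul (he _)

lemma isUnit_pfisterOf {R : Type*} [CommRing R] {n : ℕ} {a : Fin n → R} (ha : ∀ i, IsUnit (a i))
    (i : Fin (2 ^ n)) : IsUnit (pfisterOf a i) := by
  refine Submonoid.prod_mem (IsUnit.submonoid R) fun j _ => ?_
  split_ifs
  · exact isUnit_one
  · exact ha j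

lemma isHyperbolic_tensorQF_pfisterOf {F : Type*} [Field F] (h2 : (2 : F) ≠ 0) {n mr : ℕ}
    {a : Fin (n + 1) → F} (ha : ∀ i, a i ≠ 0) {r : Fin mr → F} (hr : Nondeg r) :
    IsHyperbolic (bc (algebraMap F (FunField ![1, a 0])) (tensorQF (pfisterOf a) r)) := by
  obtain ⟨i, hi⟩ := exists_sq_funField (a 0)
  obtain ⟨k, ε, hε⟩ := exists_split_equiv a r
  have h2L : IsUnit (2 : FunField ![1, a 0]) := by
    have := h2.isUnit.map (algebraMap F (FunField ![1, a 0]))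
    rwa [map_ofNat] at this
  refine isHyperbolic_of_sq h2L ((ha 0).isUnit.map _) hi (fun x => ?_) ε fun x => ?_
  · exact (isUnit_tensorQF (isUnit_pfisterOf fun i => (ha i).isUnit)
      (fun i => (hr i).isUnit) x).map (algebraMap F _)
  · simp only [bc, hε, map_mul]

lemma IsHyperbolic.of_isometric {R : Type*} [CommRing R] {m n : ℕ} {d : Fin m → R} {e : Fin n → R}
    (h : Isometric d e) (he : IsHyperbolic e) : IsHyperbolic d :=
  he.imp fun _ => h.trans

end QF

open QF in
/-- An anisotropic form `q` over `F` (char `F ≠ 2`) is hyperbolic over `F(p)` for some form `p`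
over `F` if and only if `q ≅ π ⊗ r` for some `n`-fold Pfister form `π` (`n ≥ 1`) and some
form `r` over `F`. -/
theorem stmt_3 {F : Type*} [Field F] (h2 : (2 : F) ≠ 0)
    {nq : ℕ} (q : Fin nq → F) (hq : Nondeg q) (hq0 : 0 < nq) (hqan : Anisotropic q) :
    (∃ (np : ℕ) (p : Fin np → F), 0 < np ∧ Nondeg p ∧
        IsHyperbolic (bc (algebraMap F (FunField p)) q))
    ↔ (∃ n : ℕ, 1 ≤ n ∧ ∃ (mp mr : ℕ) (π : Fin mp → F) (r : Fin mr → F),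
        IsNPfister n π ∧ 0 < mr ∧ Nondeg r ∧ Isometric q (tensorQF π r)) := by
  constructor
  · rintro ⟨np, p, hnp, hp, h⟩
    obtain ⟨r, rfl⟩ := Nat.exists_eq_succ_of_ne_zero hnp.ne'
    obtain ⟨c, m, s, hc, hm, hs, hiso⟩ := exists_isometric_of_isHyperbolic h2 hq hq0 hqan p hp h
    exact ⟨1, le_rfl, 2 ^ 1, m, _, s, ⟨_, fun _ => neg_ne_zero.2 hc, Isometric.refl _⟩, hm,
      hs, hiso⟩
  · rintro ⟨n, hn, mp, mr, π, r, ⟨a, ha, hπ⟩, -, hr, hiso⟩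
    obtain ⟨n, rfl⟩ := Nat.exists_eq_succ_of_ne_zero (Nat.one_le_iff_ne_zero.1 hn)
    refine ⟨2, ![1, a 0], two_pos, fun i => ?_, ?_⟩
    · fin_cases i
      · exact one_ne_zero
      · exact ha 0
    · exact IsHyperbolic.of_isometric ((hiso.trans (hπ.tensorQF r)).bc h2.isUnit _)
        (isHyperbolic_tensorQF_pfisterOf h2 ha hr)
end
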